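/- For all k ≥ 1, d ∈ ℕ and ε > 0 there exists a constant C = C(k,d,ε) > 0 such that: for every measurable A ⊆ ℝ^k with 0 < |A| < ∞ and |A+A| ≤ (2^{k+d+1}−ε)|A|, there exist a finite set X ⊆ ℝ^k, a proper d-GAP P ⊆ ℝ^k and a parallelotope Q ⊆ ℝ^k such that A ⊆ X+P+Q, #X ≤ C and #P · |Q| ≤ C|A|. -/

import Mathlib

open Set Pointwise MeasureTheory ENNReal

/-- `P ⊆ ℝ^k` is a `d`-dimensional generalized arithmetic progression:
`P = {∑ i, λ i • a i : 1 ≤ λ i ≤ ℓ i}`. -/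
def IsGAPR (k d : ℕ) (P : Set (Fin k → ℝ)) : Prop :=
  ∃ (a : Fin d → (Fin k → ℝ)) (l : Fin d → ℕ), (∀ i, 1 ≤ l i) ∧
    P = (fun lam : Fin d → ℕ => ∑ i, (lam i : ℝ) • a i) ''
          {lam | ∀ i, 1 ≤ lam i ∧ lam i ≤ l i}

/-- `P ⊆ ℝ^k` is a proper `d`-GAP: the parametrisation is injective. -/
def IsProperGAPR (k d : ℕ) (P : Set (Fin k → ℝ)) : Prop :=
  ∃ (a : Fin d → (Fin k → ℝ)) (l : Fin d → ℕ), (∀ i, 1 ≤ l i) ∧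
    P = (fun lam : Fin d → ℕ => ∑ i, (lam i : ℝ) • a i) ''
          {lam | ∀ i, 1 ≤ lam i ∧ lam i ≤ l i} ∧
    Set.InjOn (fun lam : Fin d → ℕ => ∑ i, (lam i : ℝ) • a i)
      {lam | ∀ i, 1 ≤ lam i ∧ lam i ≤ l i}

/-- A parallelotope in `ℝ^k`: `{x₀ + ∑ i, λ i • v i : λ i ∈ [0,1]}`. -/
def IsParallelotope (k : ℕ) (Q : Set (Fin k → ℝ)) : Prop :=
  ∃ (x₀ : Fin k → ℝ) (v : Fin k → (Fin k → ℝ)),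
    Q = (fun lam : Fin k → ℝ => x₀ + ∑ i, lam i • v i) '' (Set.Icc 0 1)

/-- A one-dimensional Prékopa–Leindler type inequality for finitely supported functions on `ℤ`. -/
theorem sum_add_sum_sub_le_sum_of_min_le (N : ℕ) :
    ∀ (S T : Finset ℤ) (f g H : ℤ → ℝ) (M : ℝ), S.card + T.card ≤ N →
      (∀ x ∈ S, 0 ≤ f x ∧ f x ≤ M) → (∀ y ∈ T, 0 ≤ g y ∧ g y ≤ M) →
      (∃ x ∈ S, f x = M) → (∃ y ∈ T, g y = M) →
      (∀ x ∈ S, ∀ y ∈ T, min (f x) (g y) ≤ H (x + y)) →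
      ∑ x ∈ S, f x + ∑ y ∈ T, g y - M ≤ ∑ z ∈ S + T, H z := by
  induction N with
  | zero =>
    rintro S T f g H M hN - - ⟨x, hx, -⟩ - -
    have : S.card = 0 := by omega
    simp_all
  | succ N ih =>
    rintro S T f g H M hN hf hg ⟨x₀, hx₀, hfx₀⟩ ⟨y₀, hy₀, hgy₀⟩ hH
    obtain ⟨x₁, hx₁, hmin₁⟩ := S.exists_min_image f ⟨x₀, hx₀⟩
    obtain ⟨y₁, hy₁, hmin₂⟩ := T.exists_min_image g ⟨y₀, hy₀⟩
    set m := min (f x₁) (g y₁) with hm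
    have hm0 : 0 ≤ m := le_min (hf x₁ hx₁).1 (hg y₁ hy₁).1
    have hmf : ∀ x ∈ S, m ≤ f x := fun x hx => (min_le_left _ _).trans (hmin₁ x hx)
    have hmg : ∀ y ∈ T, m ≤ g y := fun y hy => (min_le_right _ _).trans (hmin₂ y hy)
    have hmM : m ≤ M := hfx₀ ▸ hmf x₀ hx₀
    have hHm : ∀ z ∈ S + T, m ≤ H z := by
      intro z hz
      obtain ⟨x, hx, y, hy, rfl⟩ := Finset.mem_add.1 hz
      exact (le_min (hmf x hx) (hmg y hy)).trans (hH x hx y hy)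
    have hcard : (S.card : ℝ) + T.card - 1 ≤ (S + T).card := by
      have h1 := cauchy_davenport_add_of_linearOrder_isCancelAdd (s := S) (t := T)
        ⟨x₀, hx₀⟩ ⟨y₀, hy₀⟩
      have h2 : S.card + T.card ≤ (S + T).card + 1 := by omega
      have h3 : (S.card : ℝ) + T.card ≤ (S + T).card + 1 := by exact_mod_cast h2
      linarith
    have hsplit : ∑ z ∈ S + T, H z = (S + T).card * m + ∑ z ∈ S + T, (H z - m) := by
      rw [Finset.sum_sub_distrib]; simp
    have hsf : ∑ x ∈ S, f x = S.card * m + ∑ x ∈ S, (f x - m) := by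
      rw [Finset.sum_sub_distrib]; simp
    have hsg : ∑ x ∈ T, g x = T.card * m + ∑ x ∈ T, (g x - m) := by
      rw [Finset.sum_sub_distrib]; simp
    have hbase := mul_le_mul_of_nonneg_right hcard hm0
    rcases hmM.eq_or_lt with hEq | hlt
    · have h1 : ∑ x ∈ S, (f x - m) = 0 := Finset.sum_eq_zero fun x hx => by
        linarith [hmf x hx, (hf x hx).2]
      have h2 : ∑ x ∈ T, (g x - m) = 0 := Finset.sum_eq_zero fun x hx => by
        linarith [hmg x hx, (hg x hx).2]
      have h3 : 0 ≤ ∑ z ∈ S + T, (H z - m) := Finset.sum_nonneg fun z hz => by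
        linarith [hHm z hz]
      linarith
    set S' := S.filter (fun x => m < f x) with hS'
    set T' := T.filter (fun x => m < g x) with hT'
    have h1 : ∑ x ∈ S, (f x - m) = ∑ x ∈ S', (f x - m) := by
      rw [hS', Finset.sum_filter_of_ne]
      intro x hx hne
      exact lt_of_le_of_ne (hmf x hx) (fun h => hne (by linarith))
    have h2 : ∑ x ∈ T, (g x - m) = ∑ x ∈ T', (g x - m) := by
      rw [hT', Finset.sum_filter_of_ne]
      intro x hx hne
      exact lt_of_le_of_ne (hmg x hx) (fun h => hne (by linarith))
    have hSsub : S' ⊆ S := Finset.filter_subset _ _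
    have hTsub : T' ⊆ T := Finset.filter_subset _ _
    have h3 : ∑ z ∈ S' + T', (H z - m) ≤ ∑ z ∈ S + T, (H z - m) :=
      Finset.sum_le_sum_of_subset_of_nonneg (Finset.add_subset_add hSsub hTsub)
        fun z hz _ => by linarith [hHm z hz]
    have hcard' : S'.card + T'.card ≤ N := by
      have hlt' : S'.card + T'.card < S.card + T.card := by
        rcases min_choice (f x₁) (g y₁) with h | h
        · have : S'.card < S.card := Finset.card_lt_card <| Finset.filter_ssubset.2
            ⟨x₁, hx₁, by rw [hm, h]; simp⟩
          have := Finset.card_le_card hTsub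
          omega
        · have : T'.card < T.card := Finset.card_lt_card <| Finset.filter_ssubset.2
            ⟨y₁, hy₁, by rw [hm, h]; simp⟩
          have := Finset.card_le_card hSsub
          omega
      omega
    have h4 := ih S' T' (fun x => f x - m) (fun y => g y - m) (fun z => H z - m) (M - m) hcard'
      (fun x hx => ⟨by linarith [hmf x (hSsub hx)], by linarith [(hf x (hSsub hx)).2]⟩)
      (fun x hx => ⟨by linarith [hmg x (hTsub hx)], by linarith [(hg x (hTsub hx)).2]⟩)
      ⟨x₀, Finset.mem_filter.2 ⟨hx₀, by linarith⟩, by linarith⟩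
      ⟨y₀, Finset.mem_filter.2 ⟨hy₀, by linarith⟩, by linarith⟩
      (fun x hx y hy => by
        have := hH x (hSsub hx) y (hTsub hy)
        rw [min_sub_sub_right]
        linarith)
    linarith

/-- The fibre of `A ⊆ ℤ^(n+1)` over `x` for the first coordinate. -/
def firstFiber {n : ℕ} (A : Finset (Fin (n + 1) → ℤ)) (x : ℤ) : Finset (Fin n → ℤ) :=
  (A.filter (fun v => v 0 = x)).image Fin.tail

theorem mem_firstFiber {n : ℕ} {A : Finset (Fin (n + 1) → ℤ)} {x : ℤ} {v : Fin n → ℤ} :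
    v ∈ firstFiber A x ↔ Fin.cons x v ∈ A := by
  simp only [firstFiber, Finset.mem_image, Finset.mem_filter]
  constructor
  · rintro ⟨w, ⟨hw, rfl⟩, rfl⟩
    rwa [Fin.cons_self_tail]
  · intro h
    exact ⟨_, ⟨h, by simp⟩, by simp⟩

theorem card_eq_sum_card_firstFiber {n : ℕ} {A : Finset (Fin (n + 1) → ℤ)} {S : Finset ℤ}
    (h : ∀ v ∈ A, v 0 ∈ S) : A.card = ∑ x ∈ S, (firstFiber A x).card := by
  rw [Finset.card_eq_sum_card_fiberwise (f := fun v => v 0) (t := S) (by intro v hv; exact h v hv)]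
  refine Finset.sum_congr rfl fun x _ => ?_
  rw [firstFiber, Finset.card_image_of_injOn]
  intro v hv w hw hvw
  simp only [Finset.coe_filter, Set.mem_ofPred_eq] at hv hw
  rw [← Fin.cons_self_tail v, ← Fin.cons_self_tail w, hvw, hv.2, hw.2]

theorem firstFiber_add_subset {n : ℕ} (A B : Finset (Fin (n + 1) → ℤ)) (x y : ℤ) :
    firstFiber A x + firstFiber B y ⊆ firstFiber (A + B) (x + y) := by
  intro v hv
  obtain ⟨a, ha, b, hb, rfl⟩ := Finset.mem_add.1 hv
  rw [mem_firstFiber] at ha hb ⊢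
  convert Finset.add_mem_add ha hb using 1
  funext i
  refine Fin.cases ?_ (fun j => ?_) i <;> simp

theorem card_le_of_forall_abs_le {n : ℕ} (h : Fin n → ℕ) (A : Finset (Fin n → ℤ))
    (hA : ∀ v ∈ A, ∀ i, |v i| ≤ h i) : A.card ≤ ∏ i, (2 * h i + 1) := by
  have hsub : A ⊆ Fintype.piFinset fun i => Finset.Icc (-(h i : ℤ)) (h i) := by
    intro v hv
    rw [Fintype.mem_piFinset]
    intro i
    rw [Finset.mem_Icc, ← abs_le]
    exact hA v hv i
  refine (Finset.card_le_card hsub).trans (le_of_eq ?_)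
  rw [Fintype.card_piFinset]
  refine Finset.prod_congr rfl fun i _ => ?_
  rw [Int.card_Icc]
  omega

set_option maxHeartbeats 800000 in
/-- A discrete Brunn–Minkowski inequality for subsets of a box with long sides. -/
theorem two_pow_mul_sqrt_sub_le_card_add (n : ℕ) :
    ∀ (h : Fin n → ℕ) (L : ℝ), 0 < L → (∀ i, L ≤ 2 * h i + 1) →
      ∀ A B : Finset (Fin n → ℤ), (∀ v ∈ A, ∀ i, |v i| ≤ h i) → (∀ v ∈ B, ∀ i, |v i| ≤ h i) →
      (2 : ℝ) ^ n * √(A.card * B.card) - n * 2 ^ n / L * ∏ i, (2 * (h i : ℝ) + 1) ≤ (A + B).card := by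
  induction n with
  | zero =>
    intro h L hL _ A B _ _
    have h1 : ∀ D : Finset (Fin 0 → ℤ), D.card ≤ 1 := fun D => Finset.card_le_one_of_subsingleton D
    rcases A.eq_empty_or_nonempty with rfl | hA
    · simp
    rcases B.eq_empty_or_nonempty with rfl | hB
    · simp
    have ha : A.card = 1 := le_antisymm (h1 A) hA.card_pos
    have hb : B.card = 1 := le_antisymm (h1 B) hB.card_pos
    have hab : 1 ≤ (A + B).card := (hA.add hB).card_pos
    simp only [ha, hb]
    norm_num
    exact Finset.nonempty_iff_ne_empty.1 (hA.add hB) |> fun h => ⟨hA, hB⟩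
  | succ n ih =>
    intro h L hL hhL A B hA hB
    have hprodpos : 0 < ∏ i, (2 * (h i : ℝ) + 1) := Finset.prod_pos fun i _ => by positivity
    have herr : 0 ≤ ((n + 1 : ℕ) : ℝ) * 2 ^ (n + 1) / L * ∏ i, (2 * (h i : ℝ) + 1) := by positivity
    rcases A.eq_empty_or_nonempty with rfl | hAne
    · simp at herr ⊢; linarith
    rcases B.eq_empty_or_nonempty with rfl | hBne
    · simp at herr ⊢; linarith
    set S := A.image (fun v => v 0) with hS
    set T := B.image (fun v => v 0) with hT
    set f : ℤ → ℝ := fun x => ((firstFiber A x).card : ℝ) with hf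
    set g : ℤ → ℝ := fun x => ((firstFiber B x).card : ℝ) with hg
    have hSne : S.Nonempty := hAne.image _
    have hTne : T.Nonempty := hBne.image _
    obtain ⟨x₀, hx₀, hmaxf⟩ := S.exists_max_image f hSne
    obtain ⟨y₀, hy₀, hmaxg⟩ := T.exists_max_image g hTne
    have hfpos : ∀ x ∈ S, 0 < f x := by
      intro x hx
      obtain ⟨v, hv, rfl⟩ := Finset.mem_image.1 hx
      have : (firstFiber A (v 0)).Nonempty :=
        ⟨Fin.tail v, mem_firstFiber.2 (by rwa [Fin.cons_self_tail])⟩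
      simp only [hf]; exact_mod_cast this.card_pos
    have hgpos : ∀ x ∈ T, 0 < g x := by
      intro x hx
      obtain ⟨v, hv, rfl⟩ := Finset.mem_image.1 hx
      have : (firstFiber B (v 0)).Nonempty :=
        ⟨Fin.tail v, mem_firstFiber.2 (by rwa [Fin.cons_self_tail])⟩
      simp only [hg]; exact_mod_cast this.card_pos
    set F := f x₀ with hF
    set G := g y₀ with hG
    have hFpos : 0 < F := hfpos _ hx₀
    have hGpos : 0 < G := hgpos _ hy₀
    set Pr : ℝ := ∏ i : Fin n, (2 * (h i.succ : ℝ) + 1) with hPr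
    have hPrpos : 0 < Pr := Finset.prod_pos fun i _ => by positivity
    have hfibA : ∀ x, ∀ v ∈ firstFiber A x, ∀ i : Fin n, |v i| ≤ h i.succ := by
      intro x v hv i
      simpa using hA _ (mem_firstFiber.1 hv) i.succ
    have hfibB : ∀ x, ∀ v ∈ firstFiber B x, ∀ i : Fin n, |v i| ≤ h i.succ := by
      intro x v hv i
      simpa using hB _ (mem_firstFiber.1 hv) i.succ
    have hFle : F ≤ Pr := by
      have := card_le_of_forall_abs_le (fun i : Fin n => h i.succ) _ (hfibA x₀)
      simp only [hF, hf, hPr]; exact_mod_cast this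
    have hGle : G ≤ Pr := by
      have := card_le_of_forall_abs_le (fun i : Fin n => h i.succ) _ (hfibB y₀)
      simp only [hG, hg, hPr]; exact_mod_cast this
    set E : ℝ := n * 2 ^ n / L * Pr with hE
    have hE0 : 0 ≤ E := by positivity
    have hstep : ∀ x y, (2 : ℝ) ^ n * √(f x * g y) ≤ (firstFiber (A + B) (x + y)).card + E := by
      intro x y
      have h1 := ih (fun i => h i.succ) L hL (fun i => hhL i.succ) (firstFiber A x) (firstFiber B y)
        (hfibA x) (hfibB y)
      have h2 : ((firstFiber A x + firstFiber B y).card : ℝ) ≤ (firstFiber (A + B) (x + y)).card := by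
        exact_mod_cast Finset.card_le_card (firstFiber_add_subset A B x y)
      simp only [hf, hg]
      linarith
    set q : ℝ := √(F * G) with hq
    have hqpos : 0 < q := Real.sqrt_pos.2 (by positivity)
    have hkey := sum_add_sum_sub_le_sum_of_min_le _ S T (fun x => f x / F) (fun y => g y / G)
      (fun z => ((firstFiber (A + B) z).card + E) / (2 ^ n * q)) 1 le_rfl
      (fun x hx => ⟨by have := hfpos x hx; positivity, (div_le_one hFpos).2 (hmaxf x hx)⟩)
      (fun y hy => ⟨by have := hgpos y hy; positivity, (div_le_one hGpos).2 (hmaxg y hy)⟩)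
      ⟨x₀, hx₀, div_self hFpos.ne'⟩ ⟨y₀, hy₀, div_self hGpos.ne'⟩
      (fun x hx y hy => by
        have ha : 0 ≤ f x / F := by have := hfpos x hx; positivity
        have hb : 0 ≤ g y / G := by have := hgpos y hy; positivity
        have h1 : min (f x / F) (g y / G) ≤ √(f x * g y) / q := by
          rw [hq, ← Real.sqrt_div (by have := hfpos x hx; have := hgpos y hy; positivity)]
          apply Real.le_sqrt_of_sq_le
          rw [mul_div_mul_comm, sq]
          exact mul_le_mul (min_le_left _ _) (min_le_right _ _) (le_min ha hb) ha
        refine h1.trans ?_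
        rw [div_le_div_iff₀ hqpos (by positivity)]
        have := mul_le_mul_of_nonneg_right (hstep x y) hqpos.le
        linarith)
    rw [← Finset.sum_div, ← Finset.sum_div, ← Finset.sum_div] at hkey
    have hsumA : (A.card : ℝ) = ∑ x ∈ S, f x := by
      have := card_eq_sum_card_firstFiber (A := A) (S := S)
        (fun v hv => Finset.mem_image_of_mem _ hv)
      simp only [hf]; exact_mod_cast this
    have hsumB : (B.card : ℝ) = ∑ x ∈ T, g x := by
      have := card_eq_sum_card_firstFiber (A := B) (S := T)
        (fun v hv => Finset.mem_image_of_mem _ hv)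
      simp only [hg]; exact_mod_cast this
    have hsumAB : ((A + B).card : ℝ) = ∑ z ∈ S + T, ((firstFiber (A + B) z).card : ℝ) := by
      have := card_eq_sum_card_firstFiber (A := A + B) (S := S + T) (fun v hv => by
        obtain ⟨a, ha, b, hb, rfl⟩ := Finset.mem_add.1 hv
        exact Finset.add_mem_add (Finset.mem_image_of_mem _ ha) (Finset.mem_image_of_mem _ hb))
      exact_mod_cast this
    have hST : ((S + T).card : ℝ) ≤ 2 * (2 * h 0 + 1) := by
      have hsub : S + T ⊆ Finset.Icc (-(2 * h 0 : ℤ)) (2 * h 0) := by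
        intro z hz
        obtain ⟨x, hx, y, hy, rfl⟩ := Finset.mem_add.1 hz
        obtain ⟨a, ha, rfl⟩ := Finset.mem_image.1 hx
        obtain ⟨b, hb, rfl⟩ := Finset.mem_image.1 hy
        have h1 := abs_le.1 (hA a ha 0)
        have h2 := abs_le.1 (hB b hb 0)
        rw [Finset.mem_Icc]
        constructor <;> linarith [h1.1, h1.2, h2.1, h2.2]
      have h1 := Finset.card_le_card hsub
      rw [Int.card_Icc] at h1
      have h2 : (S + T).card ≤ 2 * (2 * h 0 + 1) := by omega
      exact_mod_cast h2
    rw [Finset.sum_add_distrib, ← hsumA, ← hsumB, ← hsumAB, le_div_iff₀ (by positivity)] at hkey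
    simp only [Finset.sum_const, nsmul_eq_mul] at hkey
    have hamgm : 2 * √(A.card * B.card) ≤ (A.card / F + B.card / G) * q := by
      have hsA : √((A.card : ℝ) * B.card) = √(A.card / F * (B.card / G)) * q := by
        rw [hq, ← Real.sqrt_mul (by positivity)]
        congr 1
        field_simp
      rw [hsA, ← mul_assoc]
      refine mul_le_mul_of_nonneg_right ?_ hqpos.le
      have h1 := Real.sq_sqrt (show 0 ≤ (A.card : ℝ) / F by positivity)
      have h2 := Real.sq_sqrt (show 0 ≤ (B.card : ℝ) / G by positivity)
      rw [Real.sqrt_mul (by positivity)]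
      nlinarith [sq_nonneg (√((A.card : ℝ) / F) - √((B.card : ℝ) / G))]
    have hqle : q ≤ Pr := by
      rw [hq, Real.sqrt_le_left hPrpos.le, sq]
      exact mul_le_mul hFle hGle hGpos.le hPrpos.le
    have hprod : ∏ i, (2 * (h i : ℝ) + 1) = (2 * h 0 + 1) * Pr := Fin.prod_univ_succ _
    have h1 : (2 : ℝ) ^ n * q ≤ 2 ^ n / L * ((2 * h 0 + 1) * Pr) := by
      have : Pr ≤ (2 * h 0 + 1) * Pr / L := by
        rw [le_div_iff₀ hL, mul_comm]
        exact mul_le_mul_of_nonneg_right (hhL 0) hPrpos.le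
      calc (2 : ℝ) ^ n * q ≤ 2 ^ n * ((2 * h 0 + 1) * Pr / L) := by gcongr; linarith
        _ = _ := by ring
    have h2 : ((S + T).card : ℝ) * E ≤ 2 * (2 * h 0 + 1) * E := by gcongr
    have h3 : 2 * (2 * (h 0 : ℝ) + 1) * E = 2 * n * 2 ^ n / L * ((2 * h 0 + 1) * Pr) := by
      rw [hE]; ring
    have h4 : (2 : ℝ) ^ n * (2 * √(A.card * B.card)) ≤ 2 ^ n * ((A.card / F + B.card / G) * q) := by
      gcongr
    have h5 : 0 ≤ (2 : ℝ) ^ n / L * ((2 * h 0 + 1) * Pr) := by positivity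
    rw [hprod]
    push_cast
    have h6 : ((n : ℝ) + 1) * 2 ^ (n + 1) / L * ((2 * h 0 + 1) * Pr) =
        2 * n * 2 ^ n / L * ((2 * h 0 + 1) * Pr) + 2 * (2 ^ n / L * ((2 * h 0 + 1) * Pr)) := by
      ring
    have h7 : ((A.card : ℝ) / F + B.card / G - 1) * (2 ^ n * q) =
        2 ^ n * ((A.card / F + B.card / G) * q) - 2 ^ n * q := by ring
    rw [h7] at hkey
    rw [h6, pow_succ, mul_assoc]
    linarith

/-- A subgroup of a normed group has finite balls if every ball contains finitely many of its
elements. -/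
def FiniteBalls {E : Type*} [SeminormedAddCommGroup E] (L : AddSubgroup E) : Prop :=
  ∀ R : ℝ, {x | x ∈ L ∧ ‖x‖ ≤ R}.Finite

/-- Elements of the image of a lattice in the quotient by the span of lattice vectors lift to
lattice elements of comparable norm. -/
theorem exists_lift_norm_lt {E : Type*} [NormedAddCommGroup E] [NormedSpace ℝ E] {k : ℕ}
    (L : AddSubgroup E) (u : Fin k → E) (hu : ∀ i, u i ∈ L) {x : E} (hx : x ∈ L) {R : ℝ}
    (hR : ‖(Submodule.span ℝ (range u)).mkQ x‖ < R) :
    ∃ x' ∈ L, (Submodule.span ℝ (range u)).mkQ x' = (Submodule.span ℝ (range u)).mkQ x ∧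
      ‖x'‖ < R + 2⁻¹ * ∑ i, ‖u i‖ := by
  set S := Submodule.span ℝ (range u) with hS
  obtain ⟨m, hm, hmR⟩ := Submodule.Quotient.norm_mk_lt (S := S) (S.mkQ x)
    (ε := R - ‖S.mkQ x‖) (by linarith)
  have hmem : m - x ∈ S := (Submodule.Quotient.eq S).1 hm
  obtain ⟨t, ht⟩ := (Submodule.mem_span_range_iff_exists_fun ℝ).1 hmem
  have hround : ∀ i, ((round (t i) : ℤ) : ℝ) • u i ∈ L := fun i => by
    rw [Int.cast_smul_eq_zsmul]; exact L.zsmul_mem (hu i) _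
  refine ⟨x + ∑ i, ((round (t i) : ℤ) : ℝ) • u i, L.add_mem hx (L.sum_mem fun i _ => hround i),
    ?_, ?_⟩
  · rw [map_add, add_eq_left, Submodule.mkQ_apply, Submodule.Quotient.mk_eq_zero]
    exact S.sum_mem fun i _ => S.smul_mem _ (Submodule.subset_span ⟨i, rfl⟩)
  · have h1 : x + ∑ i, ((round (t i) : ℤ) : ℝ) • u i =
        m - ∑ i, (t i - (round (t i) : ℤ)) • u i := by
      simp only [sub_smul, Finset.sum_sub_distrib, ht]; abel
    rw [h1]
    have h2 : ‖∑ i, (t i - (round (t i) : ℤ)) • u i‖ ≤ 2⁻¹ * ∑ i, ‖u i‖ := by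
      rw [Finset.mul_sum]
      refine norm_sum_le_of_le _ fun i _ => ?_
      rw [norm_smul, Real.norm_eq_abs]
      gcongr
      simpa using abs_sub_round (t i)
    have h3 := norm_sub_le m (∑ i, (t i - (round (t i) : ℤ)) • u i)
    linarith

theorem FiniteBalls.map_mkQ {E : Type*} [NormedAddCommGroup E] [NormedSpace ℝ E] {k : ℕ}
    {L : AddSubgroup E} (hL : FiniteBalls L) (u : Fin k → E) (hu : ∀ i, u i ∈ L) :
    FiniteBalls (L.map (Submodule.span ℝ (range u)).mkQ.toAddMonoidHom) := by
  intro R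
  refine ((hL (R + 1 + 2⁻¹ * ∑ i, ‖u i‖)).image (Submodule.span ℝ (range u)).mkQ).subset ?_
  rintro _ ⟨⟨x, hx, rfl⟩, hR⟩
  obtain ⟨x', hx', hxx', hn⟩ := exists_lift_norm_lt L u hu hx (R := R + 1)
    (lt_of_le_of_lt hR (by linarith))
  exact ⟨x', ⟨hx', hn.le⟩, hxx'⟩

/-- A lattice in a finite-dimensional normed space has a basis which is well conditioned with
respect to the norm. -/
theorem exists_reduced_basis (n : ℕ) :
    ∃ c : ℝ, 0 < c ∧ ∀ (E : Type) [NormedAddCommGroup E] [NormedSpace ℝ E] [FiniteDimensional ℝ E]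
      (L : AddSubgroup E), Module.finrank ℝ E ≤ n → FiniteBalls L →
      ∃ r ≤ n, ∃ w : Fin r → E, (∀ i, w i ∈ L) ∧ (∀ i, w i ≠ 0) ∧
        (∀ x ∈ L, ∃ m : Fin r → ℤ, x = ∑ i, m i • w i) ∧
        ∀ (t : Fin r → ℝ) (i : Fin r), c * (|t i| * ‖w i‖) ≤ ‖∑ j, t j • w j‖ := by
  induction n with
  | zero =>
    refine ⟨1, one_pos, fun E _ _ _ L hE _ => ⟨0, le_rfl, Fin.elim0, fun i => i.elim0,
      fun i => i.elim0, fun x _ => ⟨Fin.elim0, ?_⟩, fun _ i => i.elim0⟩⟩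
    have := Module.finrank_zero_iff.1 (Nat.le_zero.1 hE)
    exact Subsingleton.elim _ _
  | succ n ih =>
    obtain ⟨c, hc, H⟩ := ih
    refine ⟨c / (c + 4 * n + 4), by positivity, fun E _ _ _ L hE hL => ?_⟩
    by_cases htriv : ∀ x ∈ L, x = 0
    · exact ⟨0, Nat.zero_le _, Fin.elim0, fun i => i.elim0, fun i => i.elim0,
        fun x hx => ⟨Fin.elim0, by simp [htriv x hx]⟩, fun _ i => i.elim0⟩
    push Not at htriv
    obtain ⟨x₁, hx₁, hx₁0⟩ := htriv
    have hfin : {x | x ∈ L ∧ x ≠ 0 ∧ ‖x‖ ≤ ‖x₁‖}.Finite :=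
      (hL ‖x₁‖).subset fun x hx => ⟨hx.1, hx.2.2⟩
    obtain ⟨w₀, ⟨hw₀L, hw₀0, hw₀le⟩, hw₀min⟩ :=
      exists_min_image _ (fun x => ‖x‖) hfin ⟨x₁, hx₁, hx₁0, le_rfl⟩
    have hmin : ∀ x ∈ L, x ≠ 0 → ‖w₀‖ ≤ ‖x‖ := by
      intro x hx hx0
      rcases le_total ‖x‖ ‖x₁‖ with h | h
      · exact hw₀min x ⟨hx, hx0, h⟩
      · exact hw₀le.trans h
    have hw₀pos : 0 < ‖w₀‖ := norm_pos_iff.2 hw₀0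
    set u : Fin 1 → E := fun _ => w₀ with hu
    set S := Submodule.span ℝ (range u) with hS
    have hSspan : S = Submodule.span ℝ {w₀} := by rw [hS, hu, range_const]
    have : IsClosed (S : Set E) := S.closed_of_finiteDimensional
    have hfr : Module.finrank ℝ (E ⧸ S) ≤ n := by
      have h1 := Submodule.finrank_quotient_add_finrank S
      have h2 : Module.finrank ℝ S = 1 := by rw [hSspan]; exact finrank_span_singleton hw₀0
      omega
    obtain ⟨r, hr, w', hw'L, hw'0, hw'gen, hw'red⟩ :=
      H (E ⧸ S) (L.map S.mkQ.toAddMonoidHom) hfr (hL.map_mkQ u fun _ => hw₀L)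
    have hlift : ∀ i, ∃ x ∈ L, S.mkQ x = w' i ∧ ‖x‖ ≤ 4 * ‖w' i‖ := by
      intro i
      obtain ⟨y, hy, hyw⟩ := hw'L i
      have hpos : 0 < ‖w' i‖ := norm_pos_iff.2 (hw'0 i)
      have hyw' : S.mkQ y = w' i := hyw
      obtain ⟨x, hx, hxy, hxn⟩ := exists_lift_norm_lt L u (fun _ => hw₀L) hy (R := 2 * ‖w' i‖)
        (by rw [← hS, hyw']; linarith)
      have hx0 : x ≠ 0 := by
        rintro rfl
        rw [← hS, map_zero, hyw'] at hxy
        exact hw'0 i hxy.symm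
      have h1 := hmin x hx hx0
      simp only [Finset.univ_unique, Finset.sum_singleton, hu] at hxn
      exact ⟨x, hx, hxy.trans hyw', by linarith⟩
    choose v hvL hvw hvn using hlift
    have hn1 : (r : ℝ) ≤ n := by exact_mod_cast hr
    refine ⟨r + 1, by omega, Fin.cons w₀ v, ?_, ?_, ?_, ?_⟩
    · intro i; refine Fin.cases ?_ (fun j => ?_) i
      · simpa using hw₀L
      · simpa using hvL j
    · intro i; refine Fin.cases ?_ (fun j => ?_) i
      · simpa using hw₀0
      · simp only [Fin.cons_succ]
        intro h
        have := hvw j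
        rw [h, map_zero] at this
        exact hw'0 j this.symm
    · intro x hx
      obtain ⟨m, hm⟩ := hw'gen (S.mkQ x) ⟨x, hx, rfl⟩
      have hmem : x - ∑ i, m i • v i ∈ S := by
        rw [← Submodule.Quotient.mk_eq_zero S, ← Submodule.mkQ_apply, map_sub, map_sum, hm]
        simp [map_zsmul, hvw]
      rw [hSspan, Submodule.mem_span_singleton] at hmem
      obtain ⟨t, ht⟩ := hmem
      have hL1 : (t - (round t : ℤ)) • w₀ ∈ L := by
        rw [sub_smul, ht, Int.cast_smul_eq_zsmul]
        exact L.sub_mem (L.sub_mem hx (L.sum_mem fun i _ => L.zsmul_mem (hvL i) _))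
          (L.zsmul_mem hw₀L _)
      have hzero : (t - (round t : ℤ)) • w₀ = 0 := by
        by_contra hne
        have h1 := hmin _ hL1 hne
        rw [norm_smul, Real.norm_eq_abs] at h1
        have h2 := abs_sub_round t
        nlinarith
      rw [sub_smul, sub_eq_zero, ht, Int.cast_smul_eq_zsmul] at hzero
      refine ⟨Fin.cons (round t) m, ?_⟩
      rw [Fin.sum_univ_succ]
      simp only [Fin.cons_zero, Fin.cons_succ]
      rw [← hzero]; abel
    · intro t i
      set X := ∑ j : Fin (r + 1), t j • (Fin.cons w₀ v : Fin (r + 1) → E) j with hX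
      have hXe : X = t 0 • w₀ + ∑ j : Fin r, t j.succ • v j := by
        rw [hX, Fin.sum_univ_succ]; simp
      have hmk : S.mkQ X = ∑ j : Fin r, t j.succ • w' j := by
        have h0 : S.mkQ w₀ = 0 := by
          rw [Submodule.mkQ_apply, Submodule.Quotient.mk_eq_zero, hSspan]
          exact Submodule.mem_span_singleton_self w₀
        rw [hXe, map_add, map_smul, h0, smul_zero, zero_add, map_sum]
        simp [hvw]
      have htail : ∀ j : Fin r, c * (|t j.succ| * ‖v j‖) ≤ 4 * ‖X‖ := by
        intro j
        have h1 := hw'red (fun j => t j.succ) j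
        rw [← hmk] at h1
        have h2 : ‖S.mkQ X‖ ≤ ‖X‖ := Submodule.Quotient.norm_mk_le _ X
        have h3 : c * (|t j.succ| * ‖v j‖) ≤ c * (|t j.succ| * (4 * ‖w' j‖)) := by
          gcongr; exact hvn j
        linarith
      have hhead : c * (|t 0| * ‖w₀‖) ≤ (c + 4 * n) * ‖X‖ := by
        have h1 : t 0 • w₀ = X - ∑ j : Fin r, t j.succ • v j := by rw [hXe]; abel
        have h2 : |t 0| * ‖w₀‖ ≤ ‖X‖ + ∑ j : Fin r, |t j.succ| * ‖v j‖ := by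
          rw [← Real.norm_eq_abs, ← norm_smul, h1]
          refine (norm_sub_le _ _).trans ?_
          gcongr
          refine norm_sum_le_of_le _ fun j _ => ?_
          rw [norm_smul, Real.norm_eq_abs]
        have h3 : c * ∑ j : Fin r, |t j.succ| * ‖v j‖ ≤ r * (4 * ‖X‖) := by
          rw [Finset.mul_sum]
          refine (Finset.sum_le_sum fun j _ => htail j).trans ?_
          simp
        have h4 : (r : ℝ) * (4 * ‖X‖) ≤ n * (4 * ‖X‖) := by gcongr
        have h5 := mul_le_mul_of_nonneg_left h2 hc.le
        linarith
      rw [div_mul_eq_mul_div, div_le_iff₀ (by positivity)]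
      have hXn := norm_nonneg X
      have hnn : (0 : ℝ) ≤ n := n.cast_nonneg
      refine Fin.cases ?_ (fun j => ?_) i
      · simp only [Fin.cons_zero]
        nlinarith
      · simp only [Fin.cons_succ]
        have := htail j
        nlinarith [mul_nonneg hc.le hXn, mul_nonneg hnn hXn]

/-- The symmetric generalized arithmetic progression with steps `a i` and lengths `h i`. -/
def symGAP {V : Type*} [AddCommGroup V] {n : ℕ} (a : Fin n → V) (h : Fin n → ℕ) : Set V :=
  {x | ∃ c : Fin n → ℤ, (∀ i, |c i| ≤ h i) ∧ x = ∑ i, c i • a i}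

/-- `A` is covered by at most `C` translates of a symmetric `n`-dimensional progression whose
volume is at most `C` times the size of `A`. -/
def HasCover {V : Type*} [AddCommGroup V] (n : ℕ) (C : ℝ) (A : Finset V) : Prop :=
  ∃ (a : Fin n → V) (h : Fin n → ℕ) (X : Finset V), (X.card : ℝ) ≤ C ∧
    (A : Set V) ⊆ X + symGAP a h ∧ ∏ i, (2 * (h i : ℝ) + 1) ≤ C * A.card

section symGAP

variable {V W : Type*} [AddCommGroup V] [AddCommGroup W] {n : ℕ}

theorem zero_mem_symGAP (a : Fin n → V) (h : Fin n → ℕ) : (0 : V) ∈ symGAP a h :=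
  ⟨0, by simp, by simp⟩

theorem neg_mem_symGAP {a : Fin n → V} {h : Fin n → ℕ} {x : V} (hx : x ∈ symGAP a h) :
    -x ∈ symGAP a h := by
  obtain ⟨c, hc, rfl⟩ := hx
  exact ⟨-c, by simpa using hc, by simp⟩

theorem add_mem_symGAP {a : Fin n → V} {h h' : Fin n → ℕ} {x y : V} (hx : x ∈ symGAP a h)
    (hy : y ∈ symGAP a h') : x + y ∈ symGAP a (h + h') := by
  obtain ⟨c, hc, rfl⟩ := hx
  obtain ⟨c', hc', rfl⟩ := hy
  refine ⟨c + c', fun i => ?_, by simp [add_smul, Finset.sum_add_distrib]⟩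
  have := abs_add_le (c i) (c' i)
  have h1 := hc i
  have h2 := hc' i
  simp only [Pi.add_apply]
  push_cast
  linarith

theorem sub_mem_symGAP {a : Fin n → V} {h h' : Fin n → ℕ} {x y : V} (hx : x ∈ symGAP a h)
    (hy : y ∈ symGAP a h') : x - y ∈ symGAP a (h + h') := by
  rw [sub_eq_add_neg]
  exact add_mem_symGAP hx (neg_mem_symGAP hy)

theorem symGAP_mono (a : Fin n → V) {h h' : Fin n → ℕ} (hh : h ≤ h') :
    symGAP a h ⊆ symGAP a h' := by
  rintro x ⟨c, hc, rfl⟩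
  exact ⟨c, fun i => (hc i).trans (by exact_mod_cast hh i), rfl⟩

theorem map_mem_symGAP (f : V →+ W) {a : Fin n → V} {h : Fin n → ℕ} {x : V}
    (hx : x ∈ symGAP a h) : f x ∈ symGAP (fun i => f (a i)) h := by
  obtain ⟨c, hc, rfl⟩ := hx
  exact ⟨c, hc, by simp [map_sum, map_zsmul]⟩

theorem exists_symGAP_of_le {r n : ℕ} (hrn : r ≤ n) (a : Fin r → V) (h : Fin r → ℕ) :
    ∃ (a' : Fin n → V) (h' : Fin n → ℕ), symGAP a h = symGAP a' h' ∧
      ∏ i, (2 * (h' i : ℝ) + 1) = ∏ i, (2 * (h i : ℝ) + 1) := by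
  induction n, hrn using Nat.le_induction with
  | base => exact ⟨a, h, rfl, rfl⟩
  | succ n _ ih =>
    obtain ⟨a', h', hsub, hprod⟩ := ih
    refine ⟨Fin.cons 0 a', Fin.cons 0 h', hsub.trans (Subset.antisymm ?_ ?_), ?_⟩
    · rintro x ⟨c, hc, rfl⟩
      refine ⟨Fin.cons 0 c, fun i => ?_, ?_⟩
      · refine Fin.cases (by simp) (fun j => ?_) i
        simpa using hc j
      · rw [Fin.sum_univ_succ]; simp
    · rintro x ⟨c, hc, rfl⟩
      refine ⟨fun i => c i.succ, fun i => by simpa using hc i.succ, ?_⟩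
      rw [Fin.sum_univ_succ]; simp
    · rw [Fin.prod_univ_succ]; simpa using hprod

theorem HasCover.mono {n n' : ℕ} {C C' : ℝ} {A : Finset V} (hA : HasCover n C A) (hn : n ≤ n')
    (hC : C ≤ C') : HasCover n' C' A := by
  obtain ⟨a, h, X, hX, hsub, hprod⟩ := hA
  obtain ⟨a', h', hs, hp⟩ := exists_symGAP_of_le hn a h
  refine ⟨a', h', X, hX.trans hC, hsub.trans (add_subset_add_left hs.subset), ?_⟩
  rw [hp]
  exact hprod.trans (by gcongr)

theorem HasCover.image [DecidableEq W] {n : ℕ} {C : ℝ} {A : Finset V} (hA : HasCover n C A)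
    (f : V →+ W) (hf : Function.Injective f) : HasCover n C (A.image f) := by
  classical
  obtain ⟨a, h, X, hX, hsub, hprod⟩ := hA
  refine ⟨fun i => f (a i), h, X.image f, ?_, ?_, ?_⟩
  · exact le_trans (by exact_mod_cast Finset.card_image_le) hX
  · intro y hy
    obtain ⟨x, hx, rfl⟩ := Finset.mem_image.1 (Finset.mem_coe.1 hy)
    obtain ⟨z, hz, p, hp, rfl⟩ := hsub hx
    exact ⟨f z, by simpa using ⟨z, hz, rfl⟩, f p, map_mem_symGAP f hp, (map_add f z p).symm⟩
  · rwa [Finset.card_image_of_injective _ hf]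

end symGAP

/-- The number of points of a lattice in a ball. -/
noncomputable def ballCount {E : Type*} [SeminormedAddCommGroup E] (L : AddSubgroup E) (R : ℝ) :
    ℕ := {x | x ∈ L ∧ ‖x‖ ≤ R}.ncard

/-- The points of the box with lengths `h`. -/
noncomputable def intBox {n : ℕ} (h : Fin n → ℕ) : Finset (Fin n → ℤ) :=
  Fintype.piFinset fun i => Finset.Icc (-(h i : ℤ)) (h i)

theorem mem_intBox {n : ℕ} {h : Fin n → ℕ} {c : Fin n → ℤ} :
    c ∈ intBox h ↔ ∀ i, |c i| ≤ h i := by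
  simp [intBox, Fintype.mem_piFinset, abs_le]

theorem card_intBox {n : ℕ} (h : Fin n → ℕ) : (intBox h).card = ∏ i, (2 * h i + 1) := by
  rw [intBox, Fintype.card_piFinset]
  refine Finset.prod_congr rfl fun i _ => ?_
  rw [Int.card_Icc]
  omega

/-- The lattice points in a ball lie in a progression whose volume is at most the number of
lattice points in a larger ball. -/
theorem exists_symGAP_of_ball (n : ℕ) :
    ∃ C : ℝ, 0 ≤ C ∧ ∀ (E : Type) [NormedAddCommGroup E] [NormedSpace ℝ E] [FiniteDimensional ℝ E]
      (L : AddSubgroup E), Module.finrank ℝ E ≤ n → FiniteBalls L → ∀ R : ℝ, 0 ≤ R →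
      ∃ (w : Fin n → E) (h : Fin n → ℕ), {x | x ∈ L ∧ ‖x‖ ≤ R} ⊆ symGAP w h ∧
        symGAP w h ⊆ {x | x ∈ L ∧ ‖x‖ ≤ C * R} ∧
        ∏ i, (2 * (h i : ℝ) + 1) ≤ ballCount L (C * R) := by
  obtain ⟨c, hc, H⟩ := exists_reduced_basis n
  refine ⟨n / c, by positivity, fun E _ _ _ L hE hL R hR => ?_⟩
  classical
  obtain ⟨r, hr, w, hwL, hw0, hgen, hred⟩ := H E L hE hL
  have hwpos : ∀ i, 0 < ‖w i‖ := fun i => norm_pos_iff.2 (hw0 i)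
  set h : Fin r → ℕ := fun i => ⌊R / (c * ‖w i‖)⌋₊ with hh
  obtain ⟨w', h', hsub, hprod⟩ := exists_symGAP_of_le hr w h
  have hball : symGAP w h ⊆ {x | x ∈ L ∧ ‖x‖ ≤ n / c * R} := by
    rintro _ ⟨m, hm, rfl⟩
    refine ⟨L.sum_mem fun i _ => L.zsmul_mem (hwL i) _, ?_⟩
    have h1 : ∀ i, ‖m i • w i‖ ≤ R / c := by
      intro i
      rw [← Int.cast_smul_eq_zsmul ℝ, norm_smul, Real.norm_eq_abs]
      have h2 : |(m i : ℝ)| ≤ h i := by exact_mod_cast hm i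
      have h3 : (h i : ℝ) ≤ R / (c * ‖w i‖) :=
        Nat.floor_le (div_nonneg hR (mul_pos hc (hwpos i)).le)
      calc |(m i : ℝ)| * ‖w i‖ ≤ R / (c * ‖w i‖) * ‖w i‖ := by gcongr; exact h2.trans h3
        _ = R / c := by have := (hwpos i).ne'; field_simp
    refine (norm_sum_le_of_le _ fun i _ => h1 i).trans ?_
    rw [Finset.sum_const, Finset.card_univ, Fintype.card_fin, nsmul_eq_mul]
    have : (r : ℝ) ≤ n := by exact_mod_cast hr
    calc (r : ℝ) * (R / c) ≤ n * (R / c) := by gcongr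
      _ = n / c * R := by ring
  refine ⟨w', h', hsub ▸ ?_, hsub ▸ hball, ?_⟩
  · rintro x ⟨hx, hxR⟩
    obtain ⟨m, hm⟩ := hgen x hx
    refine ⟨m, fun i => ?_, hm⟩
    have h1 := hred (fun j => (m j : ℝ)) i
    simp only [Int.cast_smul_eq_zsmul] at h1
    rw [← hm] at h1
    have h2 : |(m i : ℝ)| ≤ R / (c * ‖w i‖) := by
      rw [le_div_iff₀ (mul_pos hc (hwpos i))]
      linarith
    have h3 : ((m i).natAbs : ℝ) ≤ R / (c * ‖w i‖) := by
      rwa [Nat.cast_natAbs, Int.cast_abs]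
    have h4 := Nat.le_floor h3
    rw [Int.abs_eq_natAbs]
    exact_mod_cast h4
  · rw [hprod]
    have hinj : Function.Injective fun m : Fin r → ℤ => ∑ i, m i • w i := by
      intro m m' hmm
      funext i
      have h1 := hred (fun j => (m j : ℝ) - m' j) i
      simp only [sub_smul, Int.cast_smul_eq_zsmul, Finset.sum_sub_distrib] at h1
      simp only at hmm
      rw [hmm, sub_self, norm_zero] at h1
      by_contra hne
      have h2 : (0 : ℝ) < |(m i : ℝ) - m' i| := abs_pos.2 (sub_ne_zero.2 (by exact_mod_cast hne))
      have := mul_pos hc (mul_pos h2 (hwpos i))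
      linarith
    have hcard : (intBox h).card ≤ ballCount L (n / c * R) := by
      rw [← Finset.card_image_of_injective _ hinj, ← ncard_coe_finset]
      refine ncard_le_ncard ?_ (hL _)
      intro x hx
      obtain ⟨m, hm, rfl⟩ := Finset.mem_image.1 (Finset.mem_coe.1 hx)
      exact hball ⟨m, mem_intBox.1 hm, rfl⟩
    rw [card_intBox] at hcard
    exact_mod_cast hcard

/-- The lattice of integer vectors rescaled by `h`. -/
noncomputable def boxVec {n : ℕ} (h : Fin n → ℕ) : (Fin n → ℤ) →+ (Fin n → ℝ) where
  toFun c i := c i / h i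
  map_zero' := by ext; simp
  map_add' c c' := by ext; simp [add_div]

theorem boxVec_norm_le {n : ℕ} {h : Fin n → ℕ} (hh : ∀ i, 0 < h i) {R : ℝ} (hR : 0 ≤ R)
    (c : Fin n → ℤ) : ‖boxVec h c‖ ≤ R ↔ ∀ i, (|c i| : ℝ) ≤ R * h i := by
  rw [pi_norm_le_iff_of_nonneg hR]
  refine forall_congr' fun i => ?_
  have : (0 : ℝ) < h i := by exact_mod_cast hh i
  change ‖(c i : ℝ) / h i‖ ≤ R ↔ _
  rw [norm_div, Real.norm_eq_abs, Real.norm_eq_abs, abs_of_pos this, div_le_iff₀ this]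

theorem boxVec_ball_subset {n : ℕ} {h : Fin n → ℕ} (hh : ∀ i, 0 < h i) {R : ℝ} (hR : 0 ≤ R) :
    {x | x ∈ (boxVec h).range ∧ ‖x‖ ≤ R} ⊆
      ((intBox fun i => ⌊R * h i⌋₊).image (boxVec h) : Finset (Fin n → ℝ)) := by
  rintro _ ⟨⟨c, rfl⟩, hc⟩
  rw [boxVec_norm_le hh hR] at hc
  refine Finset.mem_coe.2 (Finset.mem_image_of_mem _ (mem_intBox.2 fun i => ?_))
  have h3 : ((c i).natAbs : ℝ) ≤ R * h i := by
    rw [Nat.cast_natAbs, Int.cast_abs]; exact hc i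
  have h4 := Nat.le_floor h3
  rw [Int.abs_eq_natAbs]
  exact_mod_cast h4

theorem finiteBalls_boxVec {n : ℕ} {h : Fin n → ℕ} (hh : ∀ i, 0 < h i) :
    FiniteBalls (boxVec h).range := by
  intro R
  refine (Finset.finite_toSet _).subset
    (Subset.trans ?_ (boxVec_ball_subset hh (le_max_right R 0)))
  exact fun x hx => ⟨hx.1, hx.2.trans (le_max_left _ _)⟩

theorem ballCount_boxVec_le {n : ℕ} {h : Fin n → ℕ} (hh : ∀ i, 0 < h i) {R : ℝ} (hR : 0 ≤ R) :
    (ballCount (boxVec h).range R : ℝ) ≤ (R + 1) ^ n * ∏ i, (2 * (h i : ℝ) + 1) := by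
  have h1 : ballCount (boxVec h).range R ≤ ∏ i, (2 * ⌊R * h i⌋₊ + 1) := by
    rw [← card_intBox]
    refine le_trans (ncard_le_ncard (boxVec_ball_subset hh hR) (Finset.finite_toSet _)) ?_
    rw [ncard_coe_finset]
    exact Finset.card_image_le
  calc (ballCount (boxVec h).range R : ℝ) ≤ ∏ i, (2 * (⌊R * h i⌋₊ : ℝ) + 1) := by exact_mod_cast h1
    _ ≤ ∏ i : Fin n, (R + 1) * (2 * (h i : ℝ) + 1) := by
        refine Finset.prod_le_prod (fun i _ => by positivity) fun i _ => ?_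
        have h2 : (⌊R * h i⌋₊ : ℝ) ≤ R * h i := Nat.floor_le (by positivity)
        nlinarith [(h i).cast_nonneg (α := ℝ)]
    _ = _ := by rw [Finset.prod_mul_distrib]; simp

theorem ballCount_mono {E : Type*} [SeminormedAddCommGroup E] {L : AddSubgroup E}
    (hL : FiniteBalls L) {R R' : ℝ} (h : R ≤ R') : ballCount L R ≤ ballCount L R' :=
  ncard_le_ncard (fun _ hx => ⟨hx.1, hx.2.trans h⟩) (hL R')

/-- The linear map realizing the progression with steps `a` on the lattice `boxVec h`. -/
noncomputable def boxMap {V : Type*} [AddCommGroup V] [Module ℝ V] {n : ℕ} (a : Fin n → V)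
    (h : Fin n → ℕ) : (Fin n → ℝ) →ₗ[ℝ] V :=
  ∑ i, (LinearMap.proj i : (Fin n → ℝ) →ₗ[ℝ] ℝ).smulRight ((h i : ℝ) • a i)

theorem boxMap_boxVec {V : Type*} [AddCommGroup V] [Module ℝ V] {n : ℕ} (a : Fin n → V)
    {h : Fin n → ℕ} (hh : ∀ i, 0 < h i) (c : Fin n → ℤ) :
    boxMap a h (boxVec h c) = ∑ i, c i • a i := by
  simp only [boxMap, LinearMap.sum_apply, LinearMap.smulRight_apply, LinearMap.proj_apply]
  refine Finset.sum_congr rfl fun i _ => ?_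
  have : (h i : ℝ) ≠ 0 := by exact_mod_cast (hh i).ne'
  change ((c i : ℝ) / h i) • (h i : ℝ) • a i = _
  rw [smul_smul, div_mul_cancel₀ _ this, Int.cast_smul_eq_zsmul]

theorem abs_le_of_mem_intBox_add_intBox {n : ℕ} {l : Fin n → ℕ} {S T : Finset (Fin n → ℤ)}
    (hS : S ⊆ intBox l) (hT : T ⊆ intBox l) {c : Fin n → ℤ} (hc : c ∈ S + T) (i : Fin n) :
    |c i| ≤ 2 * l i := by
  obtain ⟨s, hs, t, ht, rfl⟩ := Finset.mem_add.1 hc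
  have h1 := mem_intBox.1 (hS hs) i
  have h2 := mem_intBox.1 (hT ht) i
  have h3 := abs_add_le (s i) (t i)
  simp only [Pi.add_apply]
  linarith

/-- Merging translates of a progression until they are well separated. -/
theorem exists_separated_translates {V : Type*} [AddCommGroup V] {n : ℕ} (a : Fin n → V)
    (h : Fin n → ℕ) (A : Set V) (N : ℕ) : ∀ (X : Finset V) (R : ℕ), X.card ≤ N → 1 ≤ R →
      A ⊆ X + symGAP a (R • h) →
      ∃ X' : Finset V, X'.card ≤ N ∧ ∃ R' : ℕ, 1 ≤ R' ∧ R' ≤ R * 5 ^ N ∧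
        A ⊆ X' + symGAP a (R' • h) ∧
        ∀ x ∈ X', ∀ x' ∈ X', x - x' ∈ symGAP a (4 • R' • h) → x = x' := by
  classical
  induction N with
  | zero =>
    intro X R hX hR hA
    refine ⟨X, hX, R, hR, by simp, hA, ?_⟩
    rw [Finset.card_eq_zero.1 (Nat.le_zero.1 hX)]
    simp
  | succ N ih =>
    intro X R hX hR hA
    by_cases hsep : ∀ x ∈ X, ∀ x' ∈ X, x - x' ∈ symGAP a (4 • R • h) → x = x'
    · exact ⟨X, hX, R, hR, Nat.le_mul_of_pos_right _ (by positivity), hA, hsep⟩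
    push Not at hsep
    obtain ⟨x, hx, x', hx', hmem, hne⟩ := hsep
    have hcov : A ⊆ (X.erase x : Finset V) + symGAP a ((R * 5) • h) := by
      intro v hv
      obtain ⟨z, hz, p, hp, rfl⟩ := hA hv
      have hmono : symGAP a (R • h) ⊆ symGAP a ((R * 5) • h) := symGAP_mono a fun i => by
        simp only [Pi.smul_apply, smul_eq_mul]; nlinarith [Nat.zero_le (R * h i)]
      by_cases hzx : z = x
      · subst hzx
        refine ⟨x', by simp [hne.symm, hx'], z - x' + p, ?_, by change x' + (z - x' + p) = z + p; abel⟩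
        have h1 := add_mem_symGAP hmem hp
        have h2 : 4 • R • h + R • h = (R * 5) • h := by
          ext i; simp only [Pi.add_apply, Pi.smul_apply, smul_eq_mul]; ring
        rwa [h2] at h1
      · exact ⟨z, by simp [hzx]; exact hz, p, hmono hp, rfl⟩
    obtain ⟨X', hX', R', hR', hle, hsub, hs⟩ := ih (X.erase x) (R * 5)
      (by rw [Finset.card_erase_of_mem hx]; omega) (by omega) hcov
    exact ⟨X', by omega, R', hR', by rw [pow_succ]; linarith, hsub, hs⟩

/-- A set covered by well separated translates of a proper progression has large sumset. -/
theorem two_pow_mul_sub_le_card_add {V : Type*} [AddCommGroup V] [DecidableEq V] {n : ℕ}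
    (a : Fin n → V) (l : Fin n → ℕ) (A X : Finset V) {L : ℝ} (hL : 0 < L)
    (hl : ∀ i, L ≤ 2 * l i + 1)
    (hproper : ∀ c : Fin n → ℤ, (∀ i, |c i| ≤ 4 * l i) → ∑ i, c i • a i = 0 → c = 0)
    (hsep : ∀ x ∈ X, ∀ x' ∈ X, x - x' ∈ symGAP a (4 • l) → x = x')
    (hA : (A : Set V) ⊆ X + symGAP a l) :
    2 ^ n * (A.card : ℝ) - X.card * (n * 2 ^ n / L * ∏ i, (2 * (l i : ℝ) + 1)) ≤ (A + A).card := by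
  classical
  set ψ : (Fin n → ℤ) → V := fun c => ∑ i, c i • a i with hψ
  have hψadd : ∀ c c', ψ (c + c') = ψ c + ψ c' := fun c c' => by
    simp [hψ, add_smul, Finset.sum_add_distrib]
  have hψsub : ∀ c c', ψ (c - c') = ψ c - ψ c' := fun c c' => by
    simp [hψ, sub_smul, Finset.sum_sub_distrib]
  set B : V → Finset (Fin n → ℤ) := fun x => (intBox l).filter fun c => x + ψ c ∈ A with hB
  have hBsub : ∀ x, B x ⊆ intBox l := fun x => Finset.filter_subset _ _
  have hAcard : (A.card : ℝ) ≤ ∑ x ∈ X, ((B x).card : ℝ) := by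
    have hsub : A ⊆ X.biUnion fun x => (B x).image fun c => x + ψ c := by
      intro v hv
      obtain ⟨x, hx, p, ⟨c, hc, rfl⟩, rfl⟩ := hA hv
      exact Finset.mem_biUnion.2 ⟨x, hx, Finset.mem_image.2
        ⟨c, Finset.mem_filter.2 ⟨mem_intBox.2 hc, hv⟩, rfl⟩⟩
    have h1 : A.card ≤ ∑ x ∈ X, (B x).card :=
      (Finset.card_le_card hsub).trans (Finset.card_biUnion_le.trans
        (Finset.sum_le_sum fun x _ => Finset.card_image_le))
    exact_mod_cast h1
  rcases X.eq_empty_or_nonempty with rfl | hX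
  · simp only [Finset.sum_empty] at hAcard
    have : (A.card : ℝ) = 0 := le_antisymm hAcard (Nat.cast_nonneg _)
    simp [this]
  obtain ⟨x₀, hx₀, hmax⟩ := X.exists_max_image (fun x => (B x).card) hX
  have hbig : ∀ x ∈ X, 2 ^ n * ((B x).card : ℝ) - n * 2 ^ n / L * ∏ i, (2 * (l i : ℝ) + 1) ≤
      ((B x₀ + B x).card : ℝ) := by
    intro x hx
    refine le_trans ?_ (two_pow_mul_sqrt_sub_le_card_add n l L hL hl (B x₀) (B x)
      (fun v hv => mem_intBox.1 (hBsub x₀ hv)) (fun v hv => mem_intBox.1 (hBsub x hv)))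
    gcongr
    refine Real.le_sqrt_of_sq_le ?_
    rw [sq]
    have : ((B x).card : ℝ) ≤ (B x₀).card := by exact_mod_cast hmax x hx
    gcongr
  have hTcard : ∀ x, ((B x₀ + B x).image fun c => x₀ + x + ψ c).card = (B x₀ + B x).card := by
    intro x
    refine Finset.card_image_of_injOn fun c hc c' hc' hcc => ?_
    have h1 : ψ (c - c') = 0 := by
      rw [hψsub, sub_eq_zero]; exact add_left_cancel hcc
    refine sub_eq_zero.1 (hproper _ (fun i => ?_) h1)
    have h2 := abs_le_of_mem_intBox_add_intBox (hBsub x₀) (hBsub x) hc i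
    have h3 := abs_le_of_mem_intBox_add_intBox (hBsub x₀) (hBsub x) hc' i
    have h4 := abs_sub (c i) (c' i)
    simp only [Pi.sub_apply]
    linarith
  have hdisj : (X : Set V).PairwiseDisjoint fun x => (B x₀ + B x).image fun c => x₀ + x + ψ c := by
    intro x hx x' hx' hne
    rw [Function.onFun, Finset.disjoint_left]
    intro v hv hv'
    obtain ⟨c, hc, rfl⟩ := Finset.mem_image.1 hv
    obtain ⟨c', hc', hcc⟩ := Finset.mem_image.1 hv'
    refine hne (hsep x hx x' hx' ⟨c' - c, fun i => ?_, ?_⟩)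
    · have h2 := abs_le_of_mem_intBox_add_intBox (hBsub x₀) (hBsub x) hc i
      have h3 := abs_le_of_mem_intBox_add_intBox (hBsub x₀) (hBsub x') hc' i
      have h4 := abs_sub (c' i) (c i)
      simp only [Pi.sub_apply, Pi.smul_apply, smul_eq_mul]
      push_cast
      linarith
    · change x - x' = ψ (c' - c)
      rw [hψsub]
      have hcc' : x' + ψ c' = x + ψ c := by
        have := hcc; rw [add_assoc, add_assoc] at this; exact add_left_cancel this
      rw [sub_eq_sub_iff_add_eq_add, ← hcc', add_comm]
  have hsum : ∑ x ∈ X, (B x₀ + B x).card ≤ (A + A).card := by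
    rw [← Finset.sum_congr rfl fun x _ => hTcard x, ← Finset.card_biUnion hdisj]
    refine Finset.card_le_card fun v hv => ?_
    obtain ⟨x, -, hv⟩ := Finset.mem_biUnion.1 hv
    obtain ⟨c, hc, rfl⟩ := Finset.mem_image.1 hv
    obtain ⟨s, hs, t, ht, rfl⟩ := Finset.mem_add.1 hc
    rw [hψadd, add_add_add_comm]
    exact Finset.add_mem_add (Finset.mem_filter.1 hs).2 (Finset.mem_filter.1 ht).2
  have h1 := Finset.sum_le_sum hbig
  rw [Finset.sum_sub_distrib, ← Finset.mul_sum, Finset.sum_const, nsmul_eq_mul] at h1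
  have h2 : (∑ x ∈ X, ((B x₀ + B x).card : ℝ)) ≤ (A + A).card := by exact_mod_cast hsum
  have h3 : (2 : ℝ) ^ n * A.card ≤ 2 ^ n * ∑ x ∈ X, ((B x).card : ℝ) := by gcongr
  linarith

/-- Absorbing a short direction of a progression into the set of translates. -/
theorem HasCover.of_short {V : Type*} [AddCommGroup V] {n : ℕ} {A X : Finset V}
    {a : Fin (n + 1) → V} {h : Fin (n + 1) → ℕ} {C : ℝ} (hX : (X.card : ℝ) ≤ C)
    (hsub : (A : Set V) ⊆ X + symGAP a h) (hprod : ∏ i, (2 * (h i : ℝ) + 1) ≤ C * A.card)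
    (i : Fin (n + 1)) {N : ℕ} (hi : h i ≤ N) : HasCover n (C * (2 * N + 1)) A := by
  classical
  have hC : 0 ≤ C := (Nat.cast_nonneg _).trans hX
  refine ⟨fun j => a (i.succAbove j), fun j => h (i.succAbove j),
    X + (Finset.Icc (-(N : ℤ)) N).image fun c => c • a i, ?_, ?_, ?_⟩
  · have h1 : ((X + (Finset.Icc (-(N : ℤ)) N).image fun c => c • a i).card) ≤
        X.card * (2 * N + 1) := by
      refine Finset.card_add_le.trans (Nat.mul_le_mul_left _ (Finset.card_image_le.trans ?_))
      rw [Int.card_Icc]; omega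
    calc _ ≤ (X.card : ℝ) * (2 * N + 1) := by exact_mod_cast h1
      _ ≤ _ := by gcongr
  · intro v hv
    obtain ⟨x, hx, p, ⟨c, hc, rfl⟩, rfl⟩ := hsub hv
    refine ⟨x + c i • a i, ?_, ∑ j, c (i.succAbove j) • a (i.succAbove j),
      ⟨fun j => c (i.succAbove j), fun j => hc _, rfl⟩, ?_⟩
    · refine Finset.mem_coe.2 (Finset.add_mem_add hx (Finset.mem_image_of_mem _ ?_))
      rw [Finset.mem_Icc, ← abs_le]
      exact (hc i).trans (by exact_mod_cast hi)
    · simp only []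
      rw [Fin.sum_univ_succAbove _ i, add_assoc]
  · rw [Fin.prod_univ_succAbove _ i] at hprod
    have h1 : 0 ≤ ∏ j, (2 * (h (i.succAbove j) : ℝ) + 1) := by positivity
    have h2 : (1 : ℝ) ≤ 2 * (h i : ℝ) + 1 := by linarith [(h i).cast_nonneg (α := ℝ)]
    calc ∏ j, (2 * (h (i.succAbove j) : ℝ) + 1)
        ≤ (2 * (h i : ℝ) + 1) * ∏ j, (2 * (h (i.succAbove j) : ℝ) + 1) :=
          le_mul_of_one_le_left h1 h2
      _ ≤ C * A.card := hprod
      _ ≤ C * (2 * N + 1) * A.card := by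
          have : C ≤ C * (2 * N + 1) := le_mul_of_one_le_right hC (by linarith [N.cast_nonneg (α := ℝ)])
          gcongr

theorem ballCount_map_mkQ_le {E : Type*} [NormedAddCommGroup E] [NormedSpace ℝ E] {k : ℕ}
    {L : AddSubgroup E} (hL : FiniteBalls L) (u : Fin k → E) (hu : ∀ i, u i ∈ L) (R : ℝ) :
    ballCount (L.map (Submodule.span ℝ (range u)).mkQ.toAddMonoidHom) R ≤
      ballCount L (R + 1 + 2⁻¹ * ∑ i, ‖u i‖) := by
  refine le_trans (ncard_le_ncard ?_ ((hL (R + 1 + 2⁻¹ * ∑ i, ‖u i‖)).image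
    (Submodule.span ℝ (range u)).mkQ)) (ncard_image_le (hL _))
  rintro _ ⟨⟨x, hx, rfl⟩, hR⟩
  obtain ⟨x', hx', hxx', hn⟩ := exists_lift_norm_lt L u hu hx (R := R + 1)
    (lt_of_le_of_lt hR (by linarith))
  exact ⟨x', ⟨hx', hn.le⟩, hxx'⟩

/-- A progression with a short relation is contained in one of smaller rank. -/
theorem exists_symGAP_of_relation (n m : ℕ) :
    ∃ K : ℝ, 1 ≤ K ∧ ∀ {V : Type} [AddCommGroup V] [Module ℝ V] (a : Fin (n + 1) → V)
      (h : Fin (n + 1) → ℕ), (∀ i, 0 < h i) → ∀ c : Fin (n + 1) → ℤ, c ≠ 0 →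
      (∀ i, |c i| ≤ m * h i) → ∑ i, c i • a i = 0 →
      ∃ (a' : Fin n → V) (h' : Fin n → ℕ), symGAP a h ⊆ symGAP a' h' ∧
        ∏ i, (2 * (h' i : ℝ) + 1) ≤ K * ∏ i, (2 * (h i : ℝ) + 1) := by
  obtain ⟨C, hC, H⟩ := exists_symGAP_of_ball n
  refine ⟨(C * 1 + 1 + 2⁻¹ * m + 1) ^ (n + 1), one_le_pow₀ (by nlinarith [m.cast_nonneg (α := ℝ)]),
    ?_⟩
  intro V _ _ a h hh c hc0 hcm hrel
  set γ := boxVec h c with hγ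
  have hγ0 : γ ≠ 0 := by
    obtain ⟨i, hi⟩ := Function.ne_iff.1 hc0
    refine Function.ne_iff.2 ⟨i, div_ne_zero (by exact_mod_cast hi) ?_⟩
    exact_mod_cast (hh i).ne'
  have hγn : ‖γ‖ ≤ m := by
    rw [hγ, boxVec_norm_le hh (by positivity)]
    intro i; exact_mod_cast hcm i
  set L := (boxVec h).range with hLdef
  have hL : FiniteBalls L := finiteBalls_boxVec hh
  set u : Fin 1 → (Fin (n + 1) → ℝ) := fun _ => γ with hu
  have huL : ∀ i, u i ∈ L := fun i => ⟨c, rfl⟩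
  set S := Submodule.span ℝ (range u) with hS
  have hSspan : S = Submodule.span ℝ {γ} := by rw [hS, hu, range_const]
  have : IsClosed (S : Set (Fin (n + 1) → ℝ)) := S.closed_of_finiteDimensional
  have hfr : Module.finrank ℝ ((Fin (n + 1) → ℝ) ⧸ S) ≤ n := by
    have h1 := Submodule.finrank_quotient_add_finrank S
    have h2 : Module.finrank ℝ S = 1 := by rw [hSspan]; exact finrank_span_singleton hγ0
    rw [h2, Module.finrank_fin_fun] at h1
    omega
  obtain ⟨w, h', hsub, -, hprod⟩ := H _ _ hfr (hL.map_mkQ u huL) 1 zero_le_one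
  have hker : S ≤ LinearMap.ker (boxMap a h) := by
    rw [hSspan, Submodule.span_singleton_le_iff_mem, LinearMap.mem_ker, hγ,
      boxMap_boxVec a hh, hrel]
  refine ⟨fun i => S.liftQ (boxMap a h) hker (w i), h', ?_, ?_⟩
  · rintro _ ⟨c', hc', rfl⟩
    rw [← boxMap_boxVec a hh]
    have h1 : S.mkQ (boxVec h c') ∈ symGAP w h' := by
      refine hsub ⟨⟨_, ⟨c', rfl⟩, rfl⟩, ?_⟩
      refine (Submodule.Quotient.norm_mk_le S _).trans ?_
      rw [boxVec_norm_le hh zero_le_one]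
      intro i; rw [one_mul]; exact_mod_cast hc' i
    have h2 := map_mem_symGAP (S.liftQ (boxMap a h) hker).toAddMonoidHom h1
    simpa using h2
  · refine hprod.trans ?_
    have h1 := ballCount_map_mkQ_le hL u huL (C * 1)
    have h2 : (2⁻¹ : ℝ) * ∑ i, ‖u i‖ ≤ 2⁻¹ * m := by simp [hu, hγn]
    have h3 := h1.trans (ballCount_mono hL (add_le_add_right h2 (C * 1 + 1)))
    refine le_trans (by exact_mod_cast h3) (ballCount_boxVec_le hh ?_)
    positivity

/-- Small doubling lets one decrease the rank of a covering progression. -/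
theorem HasCover.pred (n : ℕ) {ε : ℝ} (hε : 0 < ε) (C : ℝ) :
    ∃ C' : ℝ, ∀ {V : Type} [AddCommGroup V] [Module ℝ V] [DecidableEq V] (A : Finset V),
      A.Nonempty → ((A + A).card : ℝ) ≤ (2 ^ (n + 1) - ε) * A.card → HasCover (n + 1) C A →
      HasCover n C' A := by
  set N := ⌈C⌉₊ with hN
  set m := 4 * 5 ^ N with hm
  obtain ⟨K, hK1, HK⟩ := exists_symGAP_of_relation n m
  set D : ℝ := N * ((n + 1) * 2 ^ (n + 1) * (5 ^ N) ^ (n + 1) * C) with hD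
  set M := ⌈D / ε⌉₊ + 1 with hM
  refine ⟨max (C * (2 * M + 1)) (C * K), ?_⟩
  intro V _ _ _ A hAne hdoub ⟨a, h, X, hX, hsub, hprod⟩
  have hC : 0 ≤ C := (Nat.cast_nonneg _).trans hX
  have hApos : (0 : ℝ) < A.card := by exact_mod_cast hAne.card_pos
  by_cases hshort : ∃ i, h i ≤ M
  · obtain ⟨i, hi⟩ := hshort
    exact (HasCover.of_short hX hsub hprod i hi).mono le_rfl (le_max_left _ _)
  push Not at hshort
  have hh : ∀ i, 0 < h i := fun i => (Nat.zero_le _).trans_lt (hshort i)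
  by_cases hrel : ∃ c : Fin (n + 1) → ℤ, c ≠ 0 ∧ (∀ i, |c i| ≤ m * h i) ∧ ∑ i, c i • a i = 0
  · obtain ⟨c, hc0, hcm, hc⟩ := hrel
    obtain ⟨a', h', hs, hp⟩ := HK a h hh c hc0 (by exact_mod_cast hcm) hc
    refine HasCover.mono (C := C * K) ⟨a', h', X, ?_, hsub.trans (add_subset_add_left hs), ?_⟩
      le_rfl (le_max_right _ _)
    · exact hX.trans (le_mul_of_one_le_right hC hK1)
    · calc _ ≤ K * ∏ i, (2 * (h i : ℝ) + 1) := hp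
        _ ≤ K * (C * A.card) := by gcongr
        _ = _ := by ring
  push Not at hrel
  exfalso
  have hXN : X.card ≤ N := by exact_mod_cast hX.trans (Nat.le_ceil C)
  obtain ⟨X', hX', R, hR1, hRle, hsub', hsep⟩ :=
    exists_separated_translates a h A N X 1 hXN le_rfl (by simpa using hsub)
  rw [one_mul] at hRle
  have hMpos : (0 : ℝ) < M := by rw [hM]; positivity
  have key := two_pow_mul_sub_le_card_add a (R • h) A X' hMpos ?_ ?_ hsep hsub'
  · have h1 : ∏ i, (2 * ((R • h) i : ℝ) + 1) ≤ (5 ^ N) ^ (n + 1) * (C * A.card) := by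
      calc ∏ i, (2 * ((R • h) i : ℝ) + 1) ≤ ∏ i, (5 ^ N : ℝ) * (2 * (h i : ℝ) + 1) := by
            refine Finset.prod_le_prod (fun i _ => by positivity) fun i _ => ?_
            have h2 : (R : ℝ) ≤ 5 ^ N := by exact_mod_cast hRle
            have h3 : (1 : ℝ) ≤ R := by exact_mod_cast hR1
            simp only [Pi.smul_apply, smul_eq_mul]
            push_cast
            nlinarith [(h i).cast_nonneg (α := ℝ)]
        _ = (5 ^ N) ^ (n + 1) * ∏ i, (2 * (h i : ℝ) + 1) := by
            rw [Finset.prod_mul_distrib]; simp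
        _ ≤ _ := by gcongr
    have h2 : (X'.card : ℝ) ≤ N := by exact_mod_cast hX'
    have h3 : (X'.card : ℝ) * (((n + 1 : ℕ) : ℝ) * 2 ^ (n + 1) / M *
        ∏ i, (2 * ((R • h) i : ℝ) + 1)) ≤ D / M * A.card := by
      calc _ ≤ (N : ℝ) * (((n + 1 : ℕ) : ℝ) * 2 ^ (n + 1) / M *
            ((5 ^ N) ^ (n + 1) * (C * A.card))) := by
            gcongr
        _ = _ := by rw [hD]; push_cast; ring
    have h4 : D / M < ε := by
      rw [div_lt_iff₀ hMpos, ← div_lt_iff₀' hε, hM]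
      push_cast
      linarith [Nat.le_ceil (D / ε)]
    have h5 : D / M * A.card < ε * A.card := by gcongr
    linarith
  · intro i
    have h1 : M ≤ h i := (hshort i).le
    have h2 : h i ≤ R * h i := Nat.le_mul_of_pos_left _ hR1
    have h3 : (M : ℝ) ≤ R * h i := by exact_mod_cast h1.trans h2
    simp only [Pi.smul_apply, smul_eq_mul]
    push_cast
    linarith [(Nat.cast_nonneg M : (0:ℝ) ≤ M)]
  · intro c hc h0
    by_contra hc0
    refine hrel c hc0 (fun i => (hc i).trans ?_) h0
    have : 4 * (R * h i) ≤ m * h i := by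
      rw [hm, ← mul_assoc]
      gcongr
    simp only [Pi.smul_apply, smul_eq_mul]
    exact_mod_cast this

/-- Small doubling lets one decrease the rank of a covering progression to the optimal value. -/
theorem HasCover.reduce_rank (n j : ℕ) {ε : ℝ} (hε : 0 < ε) (C : ℝ) :
    ∃ C' : ℝ, ∀ {V : Type} [AddCommGroup V] [Module ℝ V] [DecidableEq V] (A : Finset V),
      A.Nonempty → ((A + A).card : ℝ) ≤ (2 ^ (n + 1) - ε) * A.card → HasCover (n + j) C A →
      HasCover n C' A := by
  induction j generalizing C with
  | zero => exact ⟨C, fun A _ _ h => h⟩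
  | succ j ih =>
    obtain ⟨C₁, H₁⟩ := HasCover.pred (n + j) hε C
    obtain ⟨C₂, H₂⟩ := ih C₁
    refine ⟨C₂, fun {V} _ _ _ A hA hd hc => H₂ A hA hd (H₁ A hA (hd.trans ?_) hc)⟩
    gcongr
    · norm_num
    · omega

section Bogolyubov

variable {N : ℕ} [NeZero N]

/-- The exponential sum over `B` at the frequency `ξ`. -/
noncomputable def expSum (B : Finset (ZMod N)) (ξ : ZMod N) : ℂ :=
  ∑ b ∈ B, ZMod.stdAddChar (ξ * b)

theorem sum_stdAddChar_mul (y : ZMod N) :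
    ∑ ξ : ZMod N, (ZMod.stdAddChar (ξ * y) : ℂ) = if y = 0 then (N : ℂ) else 0 := by
  rw [AddChar.sum_mulShift y (ZMod.isPrimitive_stdAddChar N), ZMod.card]
  split_ifs <;> simp

theorem conj_expSum (B : Finset (ZMod N)) (ξ : ZMod N) :
    (starRingEnd ℂ) (expSum B ξ) = ∑ b ∈ B, ZMod.stdAddChar (ξ * -b) := by
  rw [expSum, map_sum]
  refine Finset.sum_congr rfl fun b _ => ?_
  rw [mul_neg, AddChar.map_neg_eq_conj]

theorem norm_sq_expSum (B : Finset (ZMod N)) (ξ : ZMod N) :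
    ((‖expSum B ξ‖ ^ 2 : ℝ) : ℂ) = ∑ p ∈ B ×ˢ B, ZMod.stdAddChar (ξ * (p.1 - p.2)) := by
  push_cast
  rw [← Complex.mul_conj', conj_expSum, expSum, Finset.sum_mul_sum, Finset.sum_product]
  refine Finset.sum_congr rfl fun b _ => Finset.sum_congr rfl fun b' _ => ?_
  rw [← AddChar.map_add_eq_mul, ← mul_add, sub_eq_add_neg]

theorem sum_norm_sq_expSum (B : Finset (ZMod N)) :
    ∑ ξ : ZMod N, ‖expSum B ξ‖ ^ 2 = N * B.card := by
  have h1 : ∑ ξ : ZMod N, ((‖expSum B ξ‖ ^ 2 : ℝ) : ℂ) = ((N * B.card : ℝ) : ℂ) := by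
    simp_rw [norm_sq_expSum]
    rw [Finset.sum_comm]
    simp_rw [sum_stdAddChar_mul, sub_eq_zero]
    rw [Finset.sum_product, Finset.sum_congr rfl fun b hb => by
      rw [Finset.sum_ite_eq, if_pos hb]]
    simp [mul_comm]
  exact_mod_cast h1

theorem sum_norm_pow_four_expSum_mul_eq_zero (B : Finset (ZMod N)) {y : ZMod N}
    (hy : ∀ b₁ ∈ B, ∀ b₂ ∈ B, ∀ b₃ ∈ B, ∀ b₄ ∈ B, y ≠ b₁ + b₂ - b₃ - b₄) :
    ∑ ξ : ZMod N, (‖expSum B ξ‖ ^ 2) ^ 2 * (ZMod.stdAddChar (ξ * y) : ℂ).re = 0 := by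
  have h2 : ∀ ξ : ZMod N, (((‖expSum B ξ‖ ^ 2) ^ 2 : ℝ) : ℂ) * ZMod.stdAddChar (ξ * y) =
      ∑ p ∈ B ×ˢ B, ∑ q ∈ B ×ˢ B,
        ZMod.stdAddChar (ξ * (p.1 - p.2 + (q.1 - q.2) + y)) := by
    intro ξ
    rw [Complex.ofReal_pow, norm_sq_expSum, sq, Finset.sum_mul_sum, Finset.sum_mul]
    refine Finset.sum_congr rfl fun p _ => ?_
    rw [Finset.sum_mul]
    refine Finset.sum_congr rfl fun q _ => ?_
    rw [← AddChar.map_add_eq_mul, ← AddChar.map_add_eq_mul, ← mul_add, ← mul_add]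
  have h3 : ∑ ξ : ZMod N, (((‖expSum B ξ‖ ^ 2) ^ 2 : ℝ) : ℂ) * ZMod.stdAddChar (ξ * y) = 0 := by
    simp_rw [h2]
    rw [Finset.sum_comm]
    refine Finset.sum_eq_zero fun p hp => ?_
    rw [Finset.sum_comm]
    refine Finset.sum_eq_zero fun q hq => ?_
    rw [Finset.mem_product] at hp hq
    rw [sum_stdAddChar_mul, if_neg]
    intro h0
    refine hy p.2 hp.2 q.2 hq.2 p.1 hp.1 q.1 hq.1 ?_
    linear_combination h0
  have h4 := congrArg Complex.re h3
  rw [Complex.re_sum] at h4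
  simpa only [Complex.re_ofReal_mul, Complex.zero_re] using h4

/-- Bogolyubov's lemma. -/
theorem exists_bohr_subset {β : ℝ} (hβ : 0 < β) (B : Finset (ZMod N)) (hB : β * N ≤ B.card) :
    ∃ Γ : Finset (ZMod N), (Γ.card : ℝ) ≤ 2 / β ^ 2 ∧
      ∀ y : ZMod N, (∀ ξ ∈ Γ, 0 ≤ (ZMod.stdAddChar (ξ * y) : ℂ).re) →
        ∃ b₁ ∈ B, ∃ b₂ ∈ B, ∃ b₃ ∈ B, ∃ b₄ ∈ B, y = b₁ + b₂ - b₃ - b₄ := by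
  have hN : (0 : ℝ) < N := by exact_mod_cast Nat.pos_of_ne_zero (NeZero.ne N)
  have hBpos : (0 : ℝ) < B.card := lt_of_lt_of_le (by positivity) hB
  have hBN : (B.card : ℝ) ≤ N := by
    have := B.card_le_univ
    rw [ZMod.card] at this
    exact_mod_cast this
  have hβ1 : β ≤ 1 := by
    by_contra h
    push Not at h
    nlinarith
  set b : ℝ := (B.card : ℝ) with hb
  have hpars := sum_norm_sq_expSum B
  set Γ : Finset (ZMod N) := Finset.univ.filter fun ξ => β / 2 * b ^ 2 ≤ ‖expSum B ξ‖ ^ 2 with hΓ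
  refine ⟨Γ, ?_, fun y hy => ?_⟩
  · have h1 : Γ.card * (β / 2 * b ^ 2) ≤ N * b := by
      rw [hb, ← hpars, ← nsmul_eq_mul]
      refine (Finset.card_nsmul_le_sum Γ _ _ fun ξ hξ => (Finset.mem_filter.1 hξ).2).trans ?_
      exact Finset.sum_le_sum_of_subset_of_nonneg (Finset.subset_univ _)
        fun _ _ _ => by positivity
    rw [le_div_iff₀ (by positivity)]
    have h2 : (Γ.card * (β / 2 * b)) * b ≤ N * b := by linarith
    have h3 : Γ.card * (β / 2 * b) ≤ N := le_of_mul_le_mul_right h2 hBpos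
    have h4 : Γ.card * (β / 2 * (β * N)) ≤ Γ.card * (β / 2 * b) := by gcongr
    have h5 : (Γ.card * β ^ 2) * N ≤ 2 * N := by nlinarith
    exact le_of_mul_le_mul_right h5 hN
  · by_contra hno
    push Not at hno
    have hzero := sum_norm_pow_four_expSum_mul_eq_zero B hno
    have h0 : ‖expSum B 0‖ = b := by simp [expSum, hb]
    have h0Γ : (0 : ZMod N) ∈ Γ := by
      rw [hΓ, Finset.mem_filter, h0]
      exact ⟨Finset.mem_univ _, by nlinarith [sq_nonneg b]⟩
    rw [← Finset.sum_filter_add_sum_filter_not Finset.univ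
      (fun ξ => β / 2 * b ^ 2 ≤ ‖expSum B ξ‖ ^ 2), ← hΓ] at hzero
    have h1 : b ^ 4 ≤ ∑ ξ ∈ Γ, (‖expSum B ξ‖ ^ 2) ^ 2 * (ZMod.stdAddChar (ξ * y) : ℂ).re := by
      refine le_trans ?_ (Finset.single_le_sum (fun ξ hξ => ?_) h0Γ)
      · rw [h0]; simp; exact le_of_eq (by ring)
      · exact mul_nonneg (by positivity) (hy ξ hξ)
    have h2 : -(β / 2 * b ^ 2 * (N * b)) ≤
        ∑ ξ ∈ Finset.univ.filter (fun ξ => ¬ β / 2 * b ^ 2 ≤ ‖expSum B ξ‖ ^ 2),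
          (‖expSum B ξ‖ ^ 2) ^ 2 * (ZMod.stdAddChar (ξ * y) : ℂ).re := by
      have h3 : ∑ ξ ∈ Finset.univ.filter (fun ξ => ¬ β / 2 * b ^ 2 ≤ ‖expSum B ξ‖ ^ 2),
          ‖expSum B ξ‖ ^ 2 ≤ N * b := by
        rw [← hpars]
        exact Finset.sum_le_sum_of_subset_of_nonneg (Finset.subset_univ _)
          fun _ _ _ => by positivity
      calc -(β / 2 * b ^ 2 * (N * b))
          ≤ -(β / 2 * b ^ 2 *
            ∑ ξ ∈ Finset.univ.filter (fun ξ => ¬ β / 2 * b ^ 2 ≤ ‖expSum B ξ‖ ^ 2),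
              ‖expSum B ξ‖ ^ 2) := by gcongr
        _ = ∑ ξ ∈ Finset.univ.filter (fun ξ => ¬ β / 2 * b ^ 2 ≤ ‖expSum B ξ‖ ^ 2),
              -(β / 2 * b ^ 2 * ‖expSum B ξ‖ ^ 2) := by
            rw [Finset.mul_sum, Finset.sum_neg_distrib]
        _ ≤ _ := by
            refine Finset.sum_le_sum fun ξ hξ => ?_
            have h4 := (Finset.mem_filter.1 hξ).2
            push Not at h4
            have h5 : -1 ≤ (ZMod.stdAddChar (ξ * y) : ℂ).re := by
              have h6 := Complex.abs_re_le_norm (ZMod.stdAddChar (ξ * y) : ℂ)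
              rw [AddChar.norm_apply] at h6
              exact (abs_le.1 h6).1
            have h7 : 0 ≤ ‖expSum B ξ‖ ^ 2 := by positivity
            nlinarith [mul_nonneg (mul_nonneg h7 h7) (by linarith : (0:ℝ) ≤ 1 +
              (ZMod.stdAddChar (ξ * y) : ℂ).re), mul_nonneg h7 (sub_nonneg.2 h4.le)]
    have h8 : β / 2 * b ^ 2 * (N * b) ≤ b ^ 4 / 2 := by
      have h9 : b ^ 3 * (β * N) ≤ b ^ 3 * b := by gcongr
      nlinarith
    have h10 : 0 < b ^ 4 := by positivity
    linarith

end Bogolyubov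

/-- A homomorphism to the integers not vanishing on finitely many given nonzero vectors. -/
theorem exists_hom_ne_zero {k : ℕ} (D : Finset (Fin k → ℤ)) :
    ∃ ρ : (Fin k → ℤ) →+ ℤ, ∀ d ∈ D, ρ d = 0 → d = 0 := by
  classical
  set p : (Fin k → ℤ) → Polynomial ℤ := fun d =>
    ∑ i : Fin k, Polynomial.monomial (i : ℕ) (d i) with hp
  have hp0 : ∀ d, p d = 0 → d = 0 := by
    intro d hd
    funext i
    have h1 := congrArg (fun q => Polynomial.coeff q (i : ℕ)) hd
    simpa [hp, Polynomial.finsetSum_coeff, Polynomial.coeff_monomial, Fin.val_inj] using h1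
  obtain ⟨t, ht⟩ := Infinite.exists_notMem_finset (D.biUnion fun d => (p d).roots.toFinset)
  refine ⟨⟨⟨fun d => ∑ i : Fin k, d i * t ^ (i : ℕ), by simp⟩, fun d d' => by
    simp [add_mul, Finset.sum_add_distrib]⟩, fun d hd h0 => ?_⟩
  by_contra hne
  refine ht (Finset.mem_biUnion.2 ⟨d, hd, ?_⟩)
  rw [Multiset.mem_toFinset, Polynomial.mem_roots (fun h => hne (hp0 d h)), Polynomial.IsRoot,
    hp, Polynomial.eval_finsetSum]
  simpa using h0

/-- Ruzsa's model lemma: a large part of `A` is Freiman isomorphic (of order six) to a set of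
residues with a modulus comparable to the size of `6A - 6A`. -/
theorem exists_freiman_model {G : Type*} [AddCommGroup G] [DecidableEq G] (A D : Finset G)
    (hD : ∀ x x' : Fin 6 → G, (∀ i, x i ∈ A) → (∀ i, x' i ∈ A) → ∑ i, x i - ∑ i, x' i ∈ D)
    (h0D : (0 : G) ∈ D) (ρ : G →+ ℤ) (hρ : ∀ d ∈ D, ρ d = 0 → d = 0) :
    ∃ A' ⊆ A, ∃ F : G → ZMod (4 * D.card), A.card ≤ 6 * A'.card ∧
      ∀ x x' : Fin 6 → G, (∀ i, x i ∈ A') → (∀ i, x' i ∈ A') →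
        (∑ i, x i = ∑ i, x' i ↔ ∑ i, F (x i) = ∑ i, F (x' i)) := by
  classical
  set N := 4 * D.card with hN
  have hDpos : 0 < D.card := Finset.card_pos.2 ⟨0, h0D⟩
  obtain ⟨p, hpge, hp⟩ := Nat.exists_infinite_primes
    (2 * D.card + (∑ d ∈ D, (ρ d).natAbs) + 1)
  have : Fact p.Prime := ⟨hp⟩
  have hppos : 0 < p := hp.pos
  have hρp : ∀ d ∈ D, ((ρ d : ℤ) : ZMod p) = 0 → d = 0 := by
    intro d hd h0
    rw [ZMod.intCast_zmod_eq_zero_iff_dvd] at h0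
    have h1 : (ρ d).natAbs ≤ ∑ d ∈ D, (ρ d).natAbs :=
      Finset.single_le_sum (f := fun d => (ρ d).natAbs) (fun _ _ => Nat.zero_le _) hd
    exact hρ d hd (Int.eq_zero_of_dvd_of_natAbs_lt_natAbs h0 (by simp; omega))
  -- choose a multiplier outside the bad set
  set S : ℕ := p / N with hS
  set bad : Finset (ZMod p) := (D ×ˢ Finset.Icc (-(S : ℤ)) S).image
    fun z => ((N : ZMod p) * (z.2 : ZMod p)) * ((ρ z.1 : ℤ) : ZMod p)⁻¹ with hbad
  have hbadcard : bad.card < p := by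
    have h1 : bad.card ≤ D.card * (2 * S + 1) := by
      refine Finset.card_image_le.trans ?_
      rw [Finset.card_product, Int.card_Icc]
      apply Nat.mul_le_mul_left
      omega
    have h2 : N * S ≤ p := Nat.mul_div_le p N
    have h3 : N * S = 4 * (D.card * S) := by rw [hN, mul_assoc]
    have h4 : D.card * (2 * S + 1) = 2 * (D.card * S) + D.card := by ring
    omega
  obtain ⟨q, hq⟩ : ∃ q : ZMod p, q ∉ bad := by
    by_contra hall
    push Not at hall
    have h1 : bad = Finset.univ := Finset.eq_univ_iff_forall.2 hall
    rw [h1, Finset.card_univ, ZMod.card] at hbadcard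
    exact lt_irrefl _ hbadcard
  have hq0 : q ≠ 0 := by
    rintro rfl
    refine hq (Finset.mem_image.2 ⟨(0, 0), Finset.mem_product.2 ⟨h0D, ?_⟩, by simp⟩)
    simp
  set ψ : G → ℕ := fun x => (q * ((ρ x : ℤ) : ZMod p)).val with hψ
  have hψlt : ∀ x, ψ x < p := fun x => ZMod.val_lt _
  have hψcast : ∀ x, ((ψ x : ℤ) : ZMod p) = q * ((ρ x : ℤ) : ZMod p) := fun x => by
    simp [hψ]
  obtain ⟨j, -, hj⟩ : ∃ j ∈ Finset.range 6,
      A.card ≤ 6 * (A.filter fun x => 6 * ψ x / p = j).card := by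
    have hmaps : ∀ x ∈ A, 6 * ψ x / p ∈ Finset.range 6 := fun x _ => by
      rw [Finset.mem_range, Nat.div_lt_iff_lt_mul hppos]
      have := hψlt x
      omega
    have hsum := Finset.card_eq_sum_card_fiberwise hmaps
    by_contra hno
    push Not at hno
    have h1 : ∑ j ∈ Finset.range 6, 6 * (A.filter fun x => 6 * ψ x / p = j).card <
        ∑ j ∈ Finset.range 6, A.card :=
      Finset.sum_lt_sum_of_nonempty (by simp) fun j hj => hno j hj
    rw [← Finset.mul_sum, ← hsum] at h1
    simp at h1
  set A' := A.filter fun x => 6 * ψ x / p = j with hA'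
  refine ⟨A', Finset.filter_subset _ _, fun x => (ψ x : ZMod N), hj, ?_⟩
  intro x x' hx hx'
  set m : ℤ := ∑ i, (ψ (x i) : ℤ) - ∑ i, (ψ (x' i) : ℤ) with hm
  have hxA : ∀ i, x i ∈ A := fun i => (Finset.mem_filter.1 (hx i)).1
  have hx'A : ∀ i, x' i ∈ A := fun i => (Finset.mem_filter.1 (hx' i)).1
  have hmabs : |m| < p := by
    have h1 : ∀ y ∈ A', j * p ≤ 6 * ψ y ∧ 6 * ψ y < (j + 1) * p := by
      intro y hy
      have h2 := (Finset.mem_filter.1 hy).2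
      rw [Nat.div_eq_iff hppos] at h2
      have h3 : (j + 1) * p = j * p + p := by ring
      omega
    have h2 : ∀ i, |(ψ (x i) : ℤ) - ψ (x' i)| * 6 < p := by
      intro i
      have h3 := h1 _ (hx i)
      have h4 := h1 _ (hx' i)
      zify at h3 h4
      rw [show (6 : ℤ) = |6| by norm_num, ← abs_mul, abs_lt]
      constructor <;> nlinarith
    have h3 : |m| * 6 ≤ ∑ i : Fin 6, |(ψ (x i) : ℤ) - ψ (x' i)| * 6 := by
      rw [← Finset.sum_mul, hm, ← Finset.sum_sub_distrib]
      have := Finset.abs_sum_le_sum_abs (fun i => (ψ (x i) : ℤ) - ψ (x' i)) Finset.univ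
      linarith
    have h4 : ∑ i : Fin 6, |(ψ (x i) : ℤ) - ψ (x' i)| * 6 < ∑ _i : Fin 6, (p : ℤ) :=
      Finset.sum_lt_sum_of_nonempty (by simp) fun i _ => h2 i
    simp at h4
    linarith
  have hmp : ((m : ℤ) : ZMod p) = q * ((ρ (∑ i, x i - ∑ i, x' i) : ℤ) : ZMod p) := by
    rw [hm, map_sub, map_sum, map_sum]
    push_cast
    rw [mul_sub, Finset.mul_sum, Finset.mul_sum]
    congr 1 <;> exact Finset.sum_congr rfl fun i _ => by simpa using hψcast _
  have hF : ∑ i, (ψ (x i) : ZMod N) = ∑ i, (ψ (x' i) : ZMod N) ↔ (N : ℤ) ∣ m := by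
    rw [← ZMod.intCast_zmod_eq_zero_iff_dvd, hm]
    push_cast
    rw [sub_eq_zero]
  rw [hF]
  constructor
  · intro h
    rw [h, sub_self, map_zero, Int.cast_zero, mul_zero, ZMod.intCast_zmod_eq_zero_iff_dvd] at hmp
    rw [Int.eq_zero_of_abs_lt_dvd hmp hmabs]
    exact dvd_zero _
  · rintro ⟨s, hs⟩
    by_contra hne
    have hdD := hD x x' hxA hx'A
    have hunit : ((ρ (∑ i, x i - ∑ i, x' i) : ℤ) : ZMod p) ≠ 0 := fun h =>
      hne (sub_eq_zero.1 (hρp _ hdD h))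
    refine hq (Finset.mem_image.2 ⟨(∑ i, x i - ∑ i, x' i, s), Finset.mem_product.2 ⟨hdD, ?_⟩, ?_⟩)
    · rw [Finset.mem_Icc, ← abs_le]
      have h1 : (N : ℤ) * |s| < p := by
        rw [hs, abs_mul, abs_of_nonneg (by positivity : (0 : ℤ) ≤ N)] at hmabs
        exact hmabs
      rw [hS, Int.natCast_div, Int.le_ediv_iff_mul_le (by positivity)]
      linarith
    · rw [hs] at hmp
      push_cast at hmp
      simp only
      rw [hmp, mul_assoc, mul_inv_cancel₀ hunit, mul_one]

/-- The lattice attached to a set of frequencies: its short vectors correspond to the elements of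
the associated Bohr set. -/
noncomputable def bohrVec {N : ℕ} (Γ : Finset (ZMod N)) : (ℤ × (Γ → ℤ)) →+ (Option Γ → ℝ) where
  toFun z o := o.elim (z.1 / N) fun ξ => z.2 ξ + z.1 * ξ.1.val / N
  map_zero' := by ext o; cases o <;> simp
  map_add' z z' := by
    ext o
    cases o
    · simp [add_div]
    · simp; ring

section bohrVec

variable {N : ℕ} {Γ : Finset (ZMod N)}

@[simp] theorem bohrVec_none (z : ℤ × (Γ → ℤ)) : bohrVec Γ z none = z.1 / N := rfl

@[simp] theorem bohrVec_some (z : ℤ × (Γ → ℤ)) (ξ : Γ) :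
    bohrVec Γ z (some ξ) = z.2 ξ + z.1 * ξ.1.val / N := rfl

theorem abs_le_of_norm_bohrVec_le {z : ℤ × (Γ → ℤ)} {R : ℝ} (h : ‖bohrVec Γ z‖ ≤ R) (o) :
    |bohrVec Γ z o| ≤ R := (norm_le_pi_norm _ o).trans h

theorem finiteBalls_bohrVec [NeZero N] : FiniteBalls (bohrVec Γ).range := by
  classical
  intro R
  set T : ℤ := ⌈R * N + R⌉ with hT
  refine (((finite_Icc (-T) T).prod (finite_Icc (fun _ : Γ => -T) fun _ => T)).image
    (bohrVec Γ)).subset ?_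
  rintro _ ⟨⟨z, rfl⟩, hz⟩
  have hNpos : (0 : ℝ) < N := by exact_mod_cast Nat.pos_of_ne_zero (NeZero.ne N)
  have hR : 0 ≤ R := (norm_nonneg _).trans hz
  have hTle : R * N + R ≤ T := Int.le_ceil _
  have h1 : |(z.1 : ℝ)| ≤ R * N := by
    have := abs_le_of_norm_bohrVec_le hz none
    rwa [bohrVec_none, abs_div, abs_of_pos hNpos, div_le_iff₀ hNpos] at this
  have h2 : ∀ ξ, |(z.2 ξ : ℝ)| ≤ R * N + R := by
    intro ξ
    have h3 := abs_le_of_norm_bohrVec_le hz (some ξ)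
    rw [bohrVec_some] at h3
    have h4 : |(z.1 : ℝ) * ξ.1.val / N| ≤ R * N := by
      have h5 : (ξ.1.val : ℝ) ≤ N := by exact_mod_cast (ZMod.val_lt ξ.1).le
      rw [abs_div, abs_mul, abs_of_pos hNpos, div_le_iff₀ hNpos, Nat.abs_cast]
      gcongr
    have h6 := abs_sub (z.2 ξ + (z.1 : ℝ) * ξ.1.val / N) ((z.1 : ℝ) * ξ.1.val / N)
    rw [add_sub_cancel_right] at h6
    linarith
  refine ⟨z, ?_, rfl⟩
  have h3 : |z.1| ≤ T := by
    have : |(z.1 : ℝ)| ≤ T := by linarith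
    exact_mod_cast this
  have h4 : ∀ ξ, |z.2 ξ| ≤ T := fun ξ => by
    have : |(z.2 ξ : ℝ)| ≤ T := (h2 ξ).trans hTle
    exact_mod_cast this
  exact ⟨abs_le.1 h3, fun ξ => (abs_le.1 (h4 ξ)).1, fun ξ => (abs_le.1 (h4 ξ)).2⟩

theorem le_mul_ballCount_bohrVec [NeZero N] {M : ℕ} (hM : 0 < M) :
    N ≤ ballCount (bohrVec Γ).range (1 / M) * M ^ (Γ.card + 1) := by
  classical
  have hNpos : (0 : ℝ) < N := by exact_mod_cast Nat.pos_of_ne_zero (NeZero.ne N)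
  have hMpos : (0 : ℝ) < M := by exact_mod_cast hM
  set P : ℕ → Option Γ → ℝ := fun y o => o.elim ((y : ℝ) / N) fun ξ => (y : ℝ) * ξ.1.val / N with hP
  set cell : ℕ → Option Γ → ℕ := fun y o => ⌊M * Int.fract (P y o)⌋₊ with hcell
  have hmaps : ∀ y ∈ Finset.range N, cell y ∈ Fintype.piFinset fun _ : Option Γ => Finset.range M := by
    intro y _
    rw [Fintype.mem_piFinset]
    intro o
    rw [Finset.mem_range, hcell, Nat.floor_lt (by positivity)]
    have := Int.fract_lt_one (P y o)
    nlinarith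
  have hcount := Finset.card_le_mul_card_image_of_maps_to hmaps
    (ballCount (bohrVec Γ).range (1 / M)) ?_
  · simpa [Fintype.card_piFinset, Fintype.card_option] using hcount
  intro κ _
  rcases ((Finset.range N).filter fun y => cell y = κ).eq_empty_or_nonempty with he | ⟨y₀, hy₀⟩
  · rw [he]; simp
  rw [Finset.mem_filter, Finset.mem_range] at hy₀
  set v : ℕ → ℤ × (Γ → ℤ) := fun y => ((y : ℤ) - y₀, fun ξ =>
    ⌊P y₀ (some ξ)⌋ - ⌊P y (some ξ)⌋) with hv
  have hfl : ∀ y < N, ⌊P y none⌋ = 0 := fun y hy => by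
    rw [Int.floor_eq_zero_iff]
    refine ⟨by simp only [hP, Option.elim]; positivity, ?_⟩
    simp only [hP, Option.elim]
    rw [div_lt_one hNpos]
    exact_mod_cast hy
  have hvec : ∀ y < N, ∀ o, bohrVec Γ (v y) o = Int.fract (P y o) - Int.fract (P y₀ o) := by
    intro y hy o
    unfold Int.fract
    cases o with
    | none => rw [hfl y hy, hfl y₀ hy₀.1]; simp [hv, hP, sub_div]
    | some ξ => simp only [hv, bohrVec_some, hP, Option.elim]; push_cast; ring
  have hinj : InjOn (fun y => bohrVec Γ (v y)) ((Finset.range N).filter fun y => cell y = κ :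
      Finset ℕ) := by
    intro y _ y' _ hyy
    have h1 := congrFun hyy none
    simp only [bohrVec_none, hv] at h1
    rw [div_left_inj' hNpos.ne'] at h1
    have h2 : (y : ℤ) - y₀ = y' - y₀ := by exact_mod_cast h1
    omega
  rw [← ncard_coe_finset, ballCount]
  refine ncard_le_ncard_of_injOn _ (fun y hy => ⟨⟨_, rfl⟩, ?_⟩) hinj (finiteBalls_bohrVec _)
  simp only [Finset.coe_filter, Finset.mem_range, mem_ofPred_eq] at hy
  rw [pi_norm_le_iff_of_nonneg (by positivity)]
  intro o
  rw [hvec y hy.1 o, Real.norm_eq_abs]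
  have h1 : ⌊M * Int.fract (P y o)⌋₊ = ⌊M * Int.fract (P y₀ o)⌋₊ :=
    congrFun (hy.2.trans hy₀.2.symm) o
  have h2 := Nat.floor_le (by positivity : 0 ≤ M * Int.fract (P y o))
  have h3 := Nat.lt_floor_add_one (M * Int.fract (P y o))
  have h4 := Nat.floor_le (by positivity : 0 ≤ M * Int.fract (P y₀ o))
  have h5 := Nat.lt_floor_add_one (M * Int.fract (P y₀ o))
  rw [h1] at h2 h3
  rw [le_div_iff₀ hMpos, ← abs_of_pos hMpos, ← abs_mul, abs_le]
  constructor <;> nlinarith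

theorem re_stdAddChar_nonneg [NeZero N] {z : ℤ × (Γ → ℤ)} (hz : ‖bohrVec Γ z‖ ≤ 1 / 4) (ξ : ZMod N)
    (hξ : ξ ∈ Γ) : 0 ≤ (ZMod.stdAddChar (ξ * ((z.1 : ℤ) : ZMod N)) : ℂ).re := by
  have h1 := abs_le_of_norm_bohrVec_le hz (some ⟨ξ, hξ⟩)
  rw [bohrVec_some] at h1
  have h2 : ξ * ((z.1 : ℤ) : ZMod N) = (((ξ.val : ℤ) * z.1 : ℤ) : ZMod N) := by
    push_cast; rw [ZMod.natCast_zmod_val]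
  rw [h2, ZMod.stdAddChar_coe]
  set θ : ℝ := z.2 ⟨ξ, hξ⟩ + (z.1 : ℝ) * ξ.val / N with hθ
  have h3 : (2 * (Real.pi : ℂ) * Complex.I * (((ξ.val : ℤ) * z.1 : ℤ) : ℂ) / N) =
      ((2 * Real.pi * θ - z.2 ⟨ξ, hξ⟩ * (2 * Real.pi) : ℝ) : ℂ) * Complex.I := by
    rw [hθ]; push_cast; ring
  rw [h3, Complex.exp_ofReal_mul_I_re, Real.cos_sub_int_mul_two_pi]
  rw [abs_le] at h1
  apply Real.cos_nonneg_of_neg_pi_div_two_le_of_le <;> nlinarith [Real.pi_pos]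

theorem bohrVec_eq_of_intCast_eq [NeZero N] {z z' : ℤ × (Γ → ℤ)} (hz : ‖bohrVec Γ z‖ ≤ 1 / 4)
    (hz' : ‖bohrVec Γ z'‖ ≤ 1 / 4) (h : ((z.1 : ℤ) : ZMod N) = ((z'.1 : ℤ) : ZMod N)) : z = z' := by
  have hNpos : (0 : ℝ) < N := by exact_mod_cast Nat.pos_of_ne_zero (NeZero.ne N)
  have h1 := abs_le_of_norm_bohrVec_le hz none
  have h2 := abs_le_of_norm_bohrVec_le hz' none
  rw [bohrVec_none, abs_div, abs_of_pos hNpos, div_le_iff₀ hNpos] at h1 h2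
  have h3 : z.1 = z'.1 := by
    rw [← sub_eq_zero, ← Int.cast_sub, ZMod.intCast_zmod_eq_zero_iff_dvd] at h
    refine sub_eq_zero.1 (Int.eq_zero_of_abs_lt_dvd h ?_)
    have h4 := abs_sub (z.1 : ℝ) z'.1
    have h5 : |(z.1 : ℝ) - z'.1| < N := by linarith
    exact_mod_cast h5
  refine Prod.ext h3 (funext fun ξ => ?_)
  have h4 := abs_le_of_norm_bohrVec_le hz (some ξ)
  have h5 := abs_le_of_norm_bohrVec_le hz' (some ξ)
  rw [bohrVec_some] at h4 h5
  rw [← h3] at h5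
  rw [abs_le] at h4 h5
  have h6 : |(z.2 ξ : ℝ) - z'.2 ξ| < 1 := by rw [abs_lt]; constructor <;> linarith
  have h7 : |z.2 ξ - z'.2 ξ| < 1 := by exact_mod_cast h6
  exact sub_eq_zero.1 (Int.abs_lt_one_iff.1 h7)

end bohrVec

/-- A map additive on a symmetric progression is linear there. -/
theorem map_sum_zsmul_of_add {E G : Type*} [AddCommGroup E] [AddCommGroup G] {n : ℕ}
    (w : Fin n → E) (h : Fin n → ℕ) (g : E → G)
    (hg : ∀ v ∈ symGAP w h, ∀ v' ∈ symGAP w h, v + v' ∈ symGAP w h → g (v + v') = g v + g v') :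
    ∀ c : Fin n → ℤ, (∀ i, |c i| ≤ h i) → g (∑ i, c i • w i) = ∑ i, c i • g (w i) := by
  classical
  have h0 : g 0 = 0 := by
    have := hg 0 (zero_mem_symGAP w h) 0 (zero_mem_symGAP w h) (by simpa using zero_mem_symGAP w h)
    simpa using this
  suffices H : ∀ (s : ℕ) (c : Fin n → ℤ), ∑ i, (c i).natAbs = s → (∀ i, |c i| ≤ h i) →
      g (∑ i, c i • w i) = ∑ i, c i • g (w i) from fun c hc => H _ c rfl hc
  intro s
  induction s with
  | zero =>
    intro c hs _
    have hc0 : c = 0 := by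
      funext i
      have := (Finset.sum_eq_zero_iff.1 hs) i (Finset.mem_univ i)
      simpa using this
    simp [hc0, h0]
  | succ s ih =>
    intro c hs hc
    obtain ⟨i, hi⟩ : ∃ i, c i ≠ 0 := by
      by_contra hall
      push Not at hall
      simp [hall] at hs
    set e : ℤ := Int.sign (c i) with he
    have heabs : |e| = 1 := by rw [he, Int.abs_sign_of_ne_zero hi]
    have hmem : ∀ t : ℤ, |t| ≤ 1 → t • w i ∈ symGAP w h := by
      intro t ht
      refine ⟨Pi.single i t, fun j => ?_, ?_⟩
      · by_cases hj : j = i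
        · subst hj
          rw [Pi.single_eq_same]
          have := hc j
          have h1 : 1 ≤ |c j| := Int.one_le_abs hi
          linarith
        · rw [Pi.single_eq_of_ne hj]; simp
      · rw [Finset.sum_eq_single i] <;> simp +contextual [Pi.single_eq_of_ne]
    have hge : g (e • w i) = e • g (w i) := by
      rcases (abs_eq zero_le_one).1 heabs with h1 | h1
      · rw [h1, one_smul, one_smul]
      · rw [h1, neg_one_smul, neg_one_smul]
        have h2 := hg (-w i) (by simpa using hmem (-1) (by simp)) (w i)
          (by simpa using hmem 1 (by simp)) (by simpa using zero_mem_symGAP w h)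
        rw [neg_add_cancel, h0] at h2
        exact eq_neg_of_add_eq_zero_left h2.symm
    set c' : Fin n → ℤ := fun j => c j - if j = i then e else 0 with hc'
    have hc'i : (c' i).natAbs + 1 = (c i).natAbs := by
      simp only [hc', if_true]
      rcases lt_or_gt_of_ne hi with h1 | h1
      · rw [he, Int.sign_eq_neg_one_of_neg h1]; omega
      · rw [he, Int.sign_eq_one_of_pos h1]; omega
    have hc'j : ∀ j, j ≠ i → c' j = c j := fun j hj => by simp [hc', hj]
    have hc's : ∑ j, (c' j).natAbs = s := by
      rw [← Finset.add_sum_erase _ _ (Finset.mem_univ i)] at hs ⊢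
      rw [Finset.sum_congr rfl fun j hj => by rw [hc'j j (Finset.ne_of_mem_erase hj)]]
      omega
    have hc'h : ∀ j, |c' j| ≤ h j := by
      intro j
      by_cases hj : j = i
      · subst hj
        have := hc j
        rw [Int.abs_eq_natAbs] at this ⊢
        omega
      · rw [hc'j j hj]; exact hc j
    have hcc' : ∑ j, c j • w j = ∑ j, c' j • w j + e • w i := by
      simp [hc', sub_smul, Finset.sum_sub_distrib, ite_smul]
    have hccg : ∑ j, c j • g (w j) = ∑ j, c' j • g (w j) + e • g (w i) := by
      simp [hc', sub_smul, Finset.sum_sub_distrib, ite_smul]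
    rw [hccg, ← ih c' hc's hc'h, ← hge, hcc']
    exact hg _ ⟨c', hc'h, rfl⟩ _ (hmem e heabs.le) ⟨c, hc, hcc'.symm⟩

theorem sum_mem_nsmul_finset {G : Type*} [AddCommGroup G] [DecidableEq G] {A : Finset G} {n : ℕ}
    (x : Fin n → G) (hx : ∀ i, x i ∈ A) : ∑ i, x i ∈ n • A := by
  induction n with
  | zero => simp
  | succ n ih =>
    rw [Fin.sum_univ_castSucc, succ_nsmul]
    exact Finset.add_mem_add (ih _ fun i => hx _) (hx _)

theorem card_nsmul_sub_nsmul_le {G : Type*} [AddCommGroup G] [DecidableEq G] {A : Finset G}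
    (hA : A.Nonempty) {K : ℝ} (hK : ((A + A).card : ℝ) ≤ K * A.card) (m n : ℕ) :
    ((m • A - n • A).card : ℝ) ≤ K ^ (m + n) * A.card := by
  have hpos : (0 : ℝ) < A.card := by exact_mod_cast hA.card_pos
  have h1 := Finset.pluennecke_ruzsa_inequality_nsmul_sub_nsmul_add hA A m n
  have h2 : ((m • A - n • A).card : ℝ) ≤ (((A + A).card : ℝ) / A.card) ^ (m + n) * A.card := by
    have h3 := (NNRat.cast_le (K := ℝ)).2 h1
    push_cast at h3
    exact h3
  refine h2.trans ?_
  gcongr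
  rwa [div_le_iff₀ hpos]

/-- A Freiman isomorphism of order six with a dense set of residues produces a progression of
bounded rank and large size inside `2A - 2A`. -/
theorem exists_symGAP_of_model {G : Type} [AddCommGroup G] [DecidableEq G] {N : ℕ} [NeZero N]
    (A : Finset G) (F : G → ZMod N)
    (hF : ∀ x x' : Fin 6 → G, (∀ i, x i ∈ A) → (∀ i, x' i ∈ A) →
        (∑ i, x i = ∑ i, x' i ↔ ∑ i, F (x i) = ∑ i, F (x' i)))
    {β : ℝ} (hβ : 0 < β) (hdens : β * N ≤ A.card) (n M : ℕ) (hn : 2 / β ^ 2 + 1 ≤ n) (hM : 4 ≤ M)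
    {C : ℝ} (hCM : C * (1 / M) ≤ 1 / 4)
    (HC : ∀ (E : Type) [NormedAddCommGroup E] [NormedSpace ℝ E] [FiniteDimensional ℝ E]
      (L : AddSubgroup E), Module.finrank ℝ E ≤ n → FiniteBalls L → ∀ R : ℝ, 0 ≤ R →
      ∃ (w : Fin n → E) (h : Fin n → ℕ), {x | x ∈ L ∧ ‖x‖ ≤ R} ⊆ symGAP w h ∧
        symGAP w h ⊆ {x | x ∈ L ∧ ‖x‖ ≤ C * R} ∧
        ∏ i, (2 * (h i : ℝ) + 1) ≤ ballCount L (C * R)) :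
    ∃ (a : Fin n → G) (h : Fin n → ℕ), symGAP a h ⊆ (2 • A - 2 • A : Finset G) ∧
      N ≤ (symGAP a h).ncard * M ^ n ∧ ∏ i, (2 * (h i : ℝ) + 1) ≤ (2 • A - 2 • A).card := by
  classical
  have hNpos : (0 : ℝ) < N := by exact_mod_cast Nat.pos_of_ne_zero (NeZero.ne N)
  have hAne : A.Nonempty := by
    rw [← Finset.card_pos]
    have : (0 : ℝ) < A.card := lt_of_lt_of_le (by positivity) hdens
    exact_mod_cast this
  obtain ⟨a₀, ha₀⟩ := hAne
  have hFinj : InjOn F A := by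
    intro x hx y hy hxy
    have h1 := (hF ![x, a₀, a₀, a₀, a₀, a₀] ![y, a₀, a₀, a₀, a₀, a₀]
      (fun i => by fin_cases i <;> simpa) (fun i => by fin_cases i <;> simpa)).2
      (by simp [Fin.sum_univ_six, hxy])
    simpa [Fin.sum_univ_six] using h1
  obtain ⟨Γ, hΓcard, hΓ⟩ := exists_bohr_subset hβ (A.image F)
    (by rw [Finset.card_image_of_injOn hFinj]; exact hdens)
  have hΓn : Γ.card + 1 ≤ n := by
    have : (Γ.card : ℝ) + 1 ≤ n := by linarith
    exact_mod_cast this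
  set Good : ZMod N → Prop := fun y => ∃ x₁ ∈ A, ∃ x₂ ∈ A, ∃ x₃ ∈ A, ∃ x₄ ∈ A,
    y = F x₁ + F x₂ - F x₃ - F x₄ with hGood
  have hex : ∀ y : ZMod N, ∃ x : G, Good y → ∃ x₁ ∈ A, ∃ x₂ ∈ A, ∃ x₃ ∈ A, ∃ x₄ ∈ A,
      y = F x₁ + F x₂ - F x₃ - F x₄ ∧ x = x₁ + x₂ - x₃ - x₄ := by
    intro y
    by_cases hy : Good y
    · obtain ⟨x₁, h₁, x₂, h₂, x₃, h₃, x₄, h₄, h⟩ := hy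
      exact ⟨_, fun _ => ⟨x₁, h₁, x₂, h₂, x₃, h₃, x₄, h₄, h, rfl⟩⟩
    · exact ⟨0, fun h => absurd h hy⟩
  choose g₀ hg₀ using hex
  have hg₀add : ∀ y y', Good y → Good y' → Good (y + y') → g₀ (y + y') = g₀ y + g₀ y' := by
    intro y y' hy hy' hyy
    obtain ⟨x₁, h₁, x₂, h₂, x₃, h₃, x₄, h₄, h, hx⟩ := hg₀ y hy
    obtain ⟨x₁', h₁', x₂', h₂', x₃', h₃', x₄', h₄', h', hx'⟩ := hg₀ y' hy'
    obtain ⟨z₁, k₁, z₂, k₂, z₃, k₃, z₄, k₄, k, hz⟩ := hg₀ _ hyy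
    have h1 := (hF ![z₁, z₂, x₃, x₄, x₃', x₄'] ![x₁, x₂, x₁', x₂', z₃, z₄]
      (fun i => by fin_cases i <;> simpa) (fun i => by fin_cases i <;> simpa)).2 (by
        simp [Fin.sum_univ_six]
        linear_combination h + h' - k)
    simp only [Fin.sum_univ_six, Matrix.cons_val] at h1
    rw [hz, hx, hx']
    rw [← sub_eq_zero] at h1 ⊢
    rw [← h1]; abel
  have hg₀inj : ∀ y y', Good y → Good y' → g₀ y = g₀ y' → y = y' := by
    intro y y' hy hy' hyy
    obtain ⟨x₁, h₁, x₂, h₂, x₃, h₃, x₄, h₄, h, hx⟩ := hg₀ y hy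
    obtain ⟨x₁', h₁', x₂', h₂', x₃', h₃', x₄', h₄', h', hx'⟩ := hg₀ y' hy'
    rw [hx, hx'] at hyy
    have h1 := (hF ![x₁, x₂, x₃', x₄', a₀, a₀] ![x₁', x₂', x₃, x₄, a₀, a₀]
      (fun i => by fin_cases i <;> simpa) (fun i => by fin_cases i <;> simpa)).1 (by
        simp only [Fin.sum_univ_six, Matrix.cons_val]
        rw [← sub_eq_zero] at hyy ⊢
        rw [← hyy]; abel)
    simp only [Fin.sum_univ_six, Matrix.cons_val] at h1
    rw [h, h']
    linear_combination h1
  set L := (bohrVec Γ).range with hLdef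
  have hgood : ∀ z : ℤ × (Γ → ℤ), ‖bohrVec Γ z‖ ≤ 1 / 4 → Good ((z.1 : ℤ) : ZMod N) := by
    intro z hz
    obtain ⟨b₁, h₁, b₂, h₂, b₃, h₃, b₄, h₄, h⟩ :=
      hΓ ((z.1 : ℤ) : ZMod N) fun ξ hξ => re_stdAddChar_nonneg hz ξ hξ
    rw [Finset.mem_image] at h₁ h₂ h₃ h₄
    obtain ⟨x₁, k₁, rfl⟩ := h₁
    obtain ⟨x₂, k₂, rfl⟩ := h₂
    obtain ⟨x₃, k₃, rfl⟩ := h₃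
    obtain ⟨x₄, k₄, rfl⟩ := h₄
    exact ⟨x₁, k₁, x₂, k₂, x₃, k₃, x₄, k₄, h⟩
  set g : (Option Γ → ℝ) → G := fun v => g₀ ((round (N * v none) : ℤ) : ZMod N) with hg
  have hgz : ∀ z : ℤ × (Γ → ℤ), g (bohrVec Γ z) = g₀ ((z.1 : ℤ) : ZMod N) := by
    intro z
    simp only [hg, bohrVec_none]
    rw [mul_div_cancel₀ _ hNpos.ne', round_intCast]
  set T : Set (Option Γ → ℝ) := {x | x ∈ L ∧ ‖x‖ ≤ 1 / 4} with hT
  have hgadd : ∀ v ∈ T, ∀ v' ∈ T, v + v' ∈ T → g (v + v') = g v + g v' := by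
    rintro _ ⟨⟨z, rfl⟩, hz⟩ _ ⟨⟨z', rfl⟩, hz'⟩ ⟨-, hzz⟩
    rw [← map_add] at hzz ⊢
    rw [hgz, hgz, hgz]
    have h1 := hgood _ hzz
    rw [Prod.fst_add, Int.cast_add] at h1 ⊢
    exact hg₀add _ _ (hgood z hz) (hgood z' hz') h1
  have hginj : InjOn g T := by
    rintro _ ⟨⟨z, rfl⟩, hz⟩ _ ⟨⟨z', rfl⟩, hz'⟩ hzz
    rw [hgz, hgz] at hzz
    rw [bohrVec_eq_of_intCast_eq hz hz' (hg₀inj _ _ (hgood z hz) (hgood z' hz') hzz)]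
  have hgmem : ∀ v ∈ T, g v ∈ (2 • A - 2 • A : Finset G) := by
    rintro _ ⟨⟨z, rfl⟩, hz⟩
    rw [hgz]
    obtain ⟨x₁, h₁, x₂, h₂, x₃, h₃, x₄, h₄, h, hx⟩ := hg₀ _ (hgood z hz)
    rw [hx, sub_sub, two_nsmul]
    exact Finset.sub_mem_sub (Finset.add_mem_add h₁ h₂) (Finset.add_mem_add h₃ h₄)
  have hM0 : 0 < M := by omega
  have hMle : (1 : ℝ) / M ≤ 1 / 4 := by
    have : (4 : ℝ) ≤ M := by exact_mod_cast hM
    gcongr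
  obtain ⟨w, h, hsub, hball, hprod⟩ := HC (Option Γ → ℝ) L
    (by simpa [Fintype.card_option] using hΓn) finiteBalls_bohrVec (1 / M) (by positivity)
  have hPT : symGAP w h ⊆ T := hball.trans fun x hx => ⟨hx.1, hx.2.trans hCM⟩
  have hlin := map_sum_zsmul_of_add w h g fun v hv v' hv' hvv =>
    hgadd v (hPT hv) v' (hPT hv') (hPT hvv)
  have hgP : g '' symGAP w h = symGAP (fun i => g (w i)) h := by
    ext x
    constructor
    · rintro ⟨_, ⟨c, hc, rfl⟩, rfl⟩
      exact ⟨c, hc, hlin c hc⟩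
    · rintro ⟨c, hc, rfl⟩
      exact ⟨_, ⟨c, hc, rfl⟩, hlin c hc⟩
  have hsub2 : symGAP (fun i => g (w i)) h ⊆ (2 • A - 2 • A : Finset G) := by
    rw [← hgP]
    rintro _ ⟨v, hv, rfl⟩
    exact hgmem v (hPT hv)
  refine ⟨fun i => g (w i), h, hsub2, ?_, ?_⟩
  · refine (le_mul_ballCount_bohrVec (Γ := Γ) hM0).trans (Nat.mul_le_mul ?_
      (Nat.pow_le_pow_right hM0 hΓn))
    have hsubT : {x | x ∈ L ∧ ‖x‖ ≤ (1 : ℝ) / M} ⊆ T := fun v hv => ⟨hv.1, hv.2.trans hMle⟩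
    refine ncard_le_ncard_of_injOn g (fun v hv => ?_) (hginj.mono hsubT)
      ((Finset.finite_toSet _).subset hsub2)
    rw [← hgP]; exact mem_image_of_mem g (hsub hv)
  · refine hprod.trans ?_
    rw [← ncard_coe_finset (2 • A - 2 • A)]
    have hsubT : {x | x ∈ L ∧ ‖x‖ ≤ C * (1 / M)} ⊆ T := fun v hv => ⟨hv.1, hv.2.trans hCM⟩
    have hb : ballCount L (C * (1 / M)) ≤ ((2 • A - 2 • A : Finset G) : Set G).ncard :=
      ncard_le_ncard_of_injOn g (fun v hv => hgmem v (hsubT hv))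
        (hginj.mono hsubT) (Finset.finite_toSet _)
    exact_mod_cast hb

/-- Freiman's theorem for sets of integer vectors. -/
theorem exists_hasCover_of_card_add_le (K : ℝ) :
    ∃ (n : ℕ) (C : ℝ), ∀ (k : ℕ) (A : Finset (Fin k → ℤ)), A.Nonempty →
      ((A + A).card : ℝ) ≤ K * A.card → HasCover n C A := by
  set K' := max K 1 with hK'
  have hK1 : 1 ≤ K' := le_max_right _ _
  set β : ℝ := 1 / (24 * K' ^ 12) with hβdef
  have hβ : 0 < β := by positivity
  set n := ⌈2 / β ^ 2 + 1⌉₊ with hn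
  obtain ⟨C, hC, HC⟩ := exists_symGAP_of_ball n
  set M := ⌈4 * C⌉₊ + 4 with hM
  have hM4 : 4 ≤ M := by omega
  have hCM : C * (1 / M) ≤ 1 / 4 := by
    have h1 : 4 * C ≤ M := by
      rw [hM]; push_cast; linarith [Nat.le_ceil (4 * C)]
    rw [mul_one_div, div_le_iff₀ (by positivity)]
    linarith
  refine ⟨n, max (K' ^ 5 * M ^ n) (2 ^ n * K' ^ 4), fun k A hA hdoub => ?_⟩
  classical
  have hApos : (0 : ℝ) < A.card := by exact_mod_cast hA.card_pos
  have hdoub' : ((A + A).card : ℝ) ≤ K' * A.card :=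
    hdoub.trans (by gcongr; exact le_max_left _ _)
  set D := 6 • A - 6 • A with hDdef
  have hD : ∀ x x' : Fin 6 → (Fin k → ℤ), (∀ i, x i ∈ A) → (∀ i, x' i ∈ A) →
      ∑ i, x i - ∑ i, x' i ∈ D := fun x x' hx hx' =>
    Finset.sub_mem_sub (sum_mem_nsmul_finset x hx) (sum_mem_nsmul_finset x' hx')
  obtain ⟨a₀, ha₀⟩ := hA
  have h0D : 0 ∈ D := by simpa using hD (fun _ => a₀) (fun _ => a₀) (fun _ => ha₀) fun _ => ha₀
  have hDpos : 0 < D.card := Finset.card_pos.2 ⟨0, h0D⟩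
  have hDle : (D.card : ℝ) ≤ K' ^ 12 * A.card := card_nsmul_sub_nsmul_le ⟨a₀, ha₀⟩ hdoub' 6 6
  have hAD : A.card ≤ D.card := by
    refine Finset.card_le_card_of_injOn (fun x => x - a₀) (fun x hx => ?_)
      (fun x _ y _ hxy => sub_left_injective hxy)
    have h1 := hD ![x, a₀, a₀, a₀, a₀, a₀] (fun _ => a₀) (fun i => by fin_cases i <;> simpa)
      fun _ => ha₀
    have h2 : ∑ i, (![x, a₀, a₀, a₀, a₀, a₀] : Fin 6 → (Fin k → ℤ)) i - ∑ _i : Fin 6, a₀ =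
        x - a₀ := by
      simp only [Fin.sum_univ_six, Matrix.cons_val]; abel
    rwa [h2] at h1
  obtain ⟨ρ, hρ⟩ := exists_hom_ne_zero D
  obtain ⟨A', hA'A, F, hA'card, hF⟩ := exists_freiman_model A D hD h0D ρ hρ
  have : NeZero (4 * D.card) := ⟨by omega⟩
  have hdens : β * ((4 * D.card : ℕ) : ℝ) ≤ A'.card := by
    have h1 : (A.card : ℝ) ≤ 6 * A'.card := by exact_mod_cast hA'card
    rw [hβdef, div_mul_eq_mul_div, one_mul, div_le_iff₀ (by positivity)]
    push_cast
    have h2 : K' ^ 12 * A.card ≤ K' ^ 12 * (6 * A'.card) := by gcongr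
    linarith
  obtain ⟨a, h, hsub, hNle, hprod⟩ := exists_symGAP_of_model A' F hF hβ hdens n M (Nat.le_ceil _)
    hM4 hCM HC
  have hmono : (2 • A' - 2 • A' : Finset (Fin k → ℤ)) ⊆ 2 • A - 2 • A :=
    Finset.sub_subset_sub (Finset.nsmul_subset_nsmul_left hA'A) (Finset.nsmul_subset_nsmul_left hA'A)
  have hsub' : symGAP a h ⊆ (2 • A - 2 • A : Finset (Fin k → ℤ)) :=
    hsub.trans (by exact_mod_cast hmono)
  set P := ((Finset.finite_toSet _).subset hsub').toFinset with hP
  have hPcoe : (P : Set (Fin k → ℤ)) = symGAP a h := Set.Finite.coe_toFinset _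
  have hPne : P.Nonempty := ⟨0, by rw [hP, Set.Finite.mem_toFinset]; exact zero_mem_symGAP a h⟩
  have hAP : ((A + P).card : ℝ) ≤ K' ^ 5 * M ^ n * P.card := by
    have h1 : A + P ⊆ 3 • A - 2 • A := by
      intro x hx
      obtain ⟨y, hy, p, hp, rfl⟩ := Finset.mem_add.1 hx
      obtain ⟨s, hs, t, ht, rfl⟩ := Finset.mem_sub.1
        (Finset.mem_coe.1 (hsub' (by rwa [hP, Set.Finite.mem_toFinset] at hp)))
      rw [← add_sub_assoc]
      refine Finset.sub_mem_sub ?_ ht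
      rw [succ_nsmul']
      exact Finset.add_mem_add hy hs
    have h2 : ((A + P).card : ℝ) ≤ K' ^ 5 * A.card :=
      le_trans (by exact_mod_cast Finset.card_le_card h1)
        (card_nsmul_sub_nsmul_le ⟨a₀, ha₀⟩ hdoub' 3 2)
    have h3 : (A.card : ℝ) ≤ P.card * M ^ n := by
      rw [← hPcoe, ncard_coe_finset] at hNle
      have : A.card ≤ P.card * M ^ n := by omega
      exact_mod_cast this
    calc ((A + P).card : ℝ) ≤ K' ^ 5 * A.card := h2
      _ ≤ K' ^ 5 * (P.card * M ^ n) := by gcongr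
      _ = _ := by ring
  obtain ⟨X, -, hXcard, hAX⟩ := Finset.ruzsa_covering_add hPne hAP
  refine ⟨a, h + h, X, hXcard.trans (le_max_left _ _), ?_, ?_⟩
  · intro x hx
    obtain ⟨y, hy, z, hz, rfl⟩ := Finset.mem_add.1 (hAX hx)
    obtain ⟨p, hp, p', hp', rfl⟩ := Finset.mem_sub.1 hz
    rw [hP, Set.Finite.mem_toFinset] at hp hp'
    exact ⟨y, hy, p - p', sub_mem_symGAP hp hp', rfl⟩
  · have h1 : ((2 • A' - 2 • A').card : ℝ) ≤ K' ^ 4 * A.card :=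
      le_trans (by exact_mod_cast Finset.card_le_card hmono)
        (card_nsmul_sub_nsmul_le ⟨a₀, ha₀⟩ hdoub' 2 2)
    calc ∏ i, (2 * ((h + h) i : ℝ) + 1) ≤ ∏ i, 2 * (2 * (h i : ℝ) + 1) := by
          refine Finset.prod_le_prod (fun i _ => by positivity) fun i _ => ?_
          simp only [Pi.add_apply]
          push_cast
          linarith
      _ = 2 ^ n * ∏ i, (2 * (h i : ℝ) + 1) := by
          rw [Finset.prod_mul_distrib, Finset.prod_const, Finset.card_univ, Fintype.card_fin]
      _ ≤ 2 ^ n * (K' ^ 4 * A.card) :=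
          mul_le_mul_of_nonneg_left (hprod.trans h1) (by positivity)
      _ = 2 ^ n * K' ^ 4 * A.card := (mul_assoc _ _ _).symm
      _ ≤ _ := mul_le_mul_of_nonneg_right (le_max_right _ _) hApos.le

/-- Sets of integer vectors with doubling less than `2 ^ (n + 1)` are efficiently covered by
progressions of rank `n`. -/
theorem exists_hasCover_rank (n : ℕ) {ε : ℝ} (hε : 0 < ε) :
    ∃ C : ℝ, ∀ (k : ℕ) (V : Type) [AddCommGroup V] [Module ℝ V] [DecidableEq V]
      (f : (Fin k → ℤ) →+ V), Function.Injective f → ∀ A : Finset (Fin k → ℤ), A.Nonempty →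
      ((A + A).card : ℝ) ≤ (2 ^ (n + 1) - ε) * A.card → HasCover n C (A.image f) := by
  obtain ⟨r, C, H⟩ := exists_hasCover_of_card_add_le (2 ^ (n + 1) - ε)
  obtain ⟨C', H'⟩ := HasCover.reduce_rank n r hε C
  refine ⟨C', fun k V _ _ _ f hf A hA hd => H' _ (hA.image f) ?_
    ((HasCover.image (H k A hA hd) f hf).mono (Nat.le_add_left r n) le_rfl)⟩
  rw [← Finset.image_add f, Finset.card_image_of_injective _ hf,
    Finset.card_image_of_injective _ hf]
  exact hd

theorem vecMul_of_eq_sum {k : ℕ} (v : Fin k → Fin k → ℝ) (r : Fin k → ℝ) :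
    Matrix.vecMul r (Matrix.of v) = ∑ i, r i • v i := by
  ext j
  simp [Matrix.vecMul, dotProduct]

theorem volume_image_sum_smul {k : ℕ} (v : Fin k → Fin k → ℝ) (s : Set (Fin k → ℝ)) :
    volume ((fun r : Fin k → ℝ => ∑ i, r i • v i) '' s) =
      ENNReal.ofReal |(Matrix.of v).det| * volume s := by
  have h : (fun r : Fin k → ℝ => ∑ i, r i • v i) = Matrix.toLin' (Matrix.of v).transpose := by
    ext1 r
    rw [Matrix.toLin'_apply, Matrix.mulVec_transpose, vecMul_of_eq_sum]
  rw [h, Measure.addHaar_image_linearMap, LinearMap.det_toLin', Matrix.det_transpose]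

/-- A symmetric convex body is contained in a parallelotope of comparable volume. -/
theorem exists_parallelotope_of_convex {k : ℕ} {B : Set (Fin k → ℝ)} (hBc : IsCompact B)
    (hB : Convex ℝ B) (h0 : 0 ∈ B) {w : Fin k → Fin k → ℝ} (hw : ∀ i, w i ∈ B)
    (hwdet : (Matrix.of w).det ≠ 0) :
    ∃ v : Fin k → Fin k → ℝ, (Matrix.of v).det ≠ 0 ∧
      (∀ x ∈ B, ∃ r : Fin k → ℝ, (∀ i, |r i| ≤ 1) ∧ x = ∑ i, r i • v i) ∧
      ENNReal.ofReal |(Matrix.of v).det| ≤ k ^ k * volume B := by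
  obtain ⟨v, hv, hmax⟩ := (isCompact_univ_pi fun _ : Fin k => hBc).exists_isMaxOn
    ⟨w, fun i _ => hw i⟩
    (f := fun v : Fin k → Fin k → ℝ => |(Matrix.of v).det|)
    (Continuous.continuousOn (by
      apply Continuous.abs
      apply Continuous.matrix_det
      fun_prop))
  have hdet : 0 < |(Matrix.of v).det| :=
    (abs_pos.2 hwdet).trans_le (hmax (show w ∈ Set.univ.pi fun _ => B from fun i _ => hw i))
  have hdet' := abs_pos.1 hdet
  refine ⟨v, hdet', fun x hx => ?_, ?_⟩
  · obtain ⟨r, hr⟩ := Matrix.vecMul_surjective_iff_isUnit.2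
      ((Matrix.isUnit_iff_isUnit_det _).2 hdet'.isUnit) x
    replace hr : ∑ i, r i • v i = x := (vecMul_of_eq_sum v r).symm.trans hr
    refine ⟨r, fun i => ?_, hr.symm⟩
    have h1 : |((Matrix.of v).updateRow i x).det| ≤ |(Matrix.of v).det| := by
      refine hmax (show (Function.update v i x) ∈ Set.univ.pi fun _ => B from fun j _ => ?_)
      by_cases hj : j = i
      · subst hj; simpa using hx
      · simpa [hj] using hv j trivial
    have h2 := Matrix.det_updateRow_sum (Matrix.of v) i r
    have h3 : ∑ j, r j • (Matrix.of v) j = x := hr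
    rw [h3] at h2
    rw [h2, smul_eq_mul, abs_mul] at h1
    exact (mul_le_iff_le_one_left hdet).1 h1
  · have hsub : (fun r : Fin k → ℝ => ∑ i, r i • v i) '' Icc 0 (fun _ => 1 / (k : ℝ)) ⊆ B := by
      rintro _ ⟨r, ⟨hr0, hr1⟩, rfl⟩
      rcases Nat.eq_zero_or_pos k with rfl | hk
      · simpa using h0
      have hk' : (0 : ℝ) < k := by exact_mod_cast hk
      have h1 : ∑ i, r i • v i = ∑ i, (1 / (k : ℝ)) • ((k * r i) • v i) := by
        refine Finset.sum_congr rfl fun i _ => ?_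
        rw [smul_smul]; congr 1; field_simp
      simp only [h1]
      refine hB.sum_mem (fun i _ => by positivity) (by simp [hk'.ne']) fun i _ => ?_
      refine hB.smul_mem_of_zero_mem h0 (hv i trivial) ⟨mul_nonneg hk'.le (hr0 i), ?_⟩
      have := hr1 i
      rw [le_div_iff₀ hk'] at this
      linarith
    have h1 := measure_mono (μ := volume) hsub
    rw [volume_image_sum_smul, Real.volume_Icc_pi] at h1
    simp only [Pi.zero_apply, sub_zero, Finset.prod_const, Finset.card_univ, Fintype.card_fin] at h1
    rcases Nat.eq_zero_or_pos k with rfl | hk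
    · simpa using h1
    have hk' : (0 : ℝ) < k := by exact_mod_cast hk
    calc ENNReal.ofReal |(Matrix.of v).det|
        = k ^ k * (ENNReal.ofReal |(Matrix.of v).det| * ENNReal.ofReal (1 / k) ^ k) := by
          rw [mul_left_comm, ← mul_pow, ← ENNReal.ofReal_natCast, ← ENNReal.ofReal_mul hk'.le,
            mul_one_div, div_self hk'.ne']
          simp
      _ ≤ _ := by gcongr

/-- Lattice points of the quotient and of the subspace combine to distinct lattice points. -/
theorem ballCount_map_mkQ_mul_le {E : Type*} [NormedAddCommGroup E] [NormedSpace ℝ E] {k : ℕ}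
    {L : AddSubgroup E} (hL : FiniteBalls L) (u : Fin k → E) (hu : ∀ i, u i ∈ L) (R R' : ℝ) :
    ballCount (L.map (Submodule.span ℝ (range u)).mkQ.toAddMonoidHom) R *
      {x | x ∈ L ∧ x ∈ Submodule.span ℝ (range u) ∧ ‖x‖ ≤ R'}.ncard ≤
      ballCount L (R + 1 + 2⁻¹ * ∑ i, ‖u i‖ + R') := by
  set S := Submodule.span ℝ (range u) with hS
  have hlift : ∀ y : E ⧸ S, ∃ x : E, y ∈ {y | y ∈ L.map S.mkQ.toAddMonoidHom ∧ ‖y‖ ≤ R} →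
      x ∈ L ∧ S.mkQ x = y ∧ ‖x‖ ≤ R + 1 + 2⁻¹ * ∑ i, ‖u i‖ := by
    intro y
    by_cases hy : y ∈ {y | y ∈ L.map S.mkQ.toAddMonoidHom ∧ ‖y‖ ≤ R}
    · obtain ⟨⟨x, hx, rfl⟩, hR⟩ := hy
      obtain ⟨x', hx', hxx', hn⟩ := exists_lift_norm_lt L u hu hx (R := R + 1)
        (lt_of_le_of_lt hR (by linarith))
      exact ⟨x', fun _ => ⟨hx', hxx', hn.le⟩⟩
    · exact ⟨0, fun h => absurd h hy⟩
  choose g hg using hlift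
  rw [ballCount, ← ncard_prod]
  refine ncard_le_ncard_of_injOn (fun p : (E ⧸ S) × E => g p.1 + p.2) ?_ ?_ (hL _)
  · rintro ⟨y, x⟩ ⟨hy, hx⟩
    obtain ⟨h1, -, h3⟩ := hg y hy
    exact ⟨L.add_mem h1 hx.1, (norm_add_le _ _).trans (add_le_add h3 hx.2.2)⟩
  · rintro ⟨y, x⟩ ⟨hy, hx⟩ ⟨y', x'⟩ ⟨hy', hx'⟩ h
    simp only at h
    have h1 := congrArg S.mkQ h
    rw [map_add, map_add, (hg y hy).2.1, (hg y' hy').2.1, Submodule.mkQ_apply S x,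
      Submodule.mkQ_apply S x', (Submodule.Quotient.mk_eq_zero S).2 hx.2.1,
      (Submodule.Quotient.mk_eq_zero S).2 hx'.2.1, add_zero, add_zero] at h1
    subst h1
    rw [add_left_cancel h]

/-- The image of a ball has volume controlled by the number of lattice points in a larger ball. -/
theorem volume_image_ball_le {E : Type*} [NormedAddCommGroup E] [NormedSpace ℝ E] {k : ℕ}
    {L : AddSubgroup E} (hL : FiniteBalls L) (u : Fin k → E) (hu : ∀ i, u i ∈ L)
    (φ : E →ₗ[ℝ] (Fin k → ℝ)) {σ : ℝ} (s : Fin k → ℝ) (hs0 : ∀ i, 0 ≤ s i) (hs : ∀ i, s i ≤ σ)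
    (hφ : ∀ i, φ (u i) = Pi.single i (s i)) (R : ℝ) :
    volume (φ '' {x | x ∈ Submodule.span ℝ (range u) ∧ ‖x‖ ≤ R}) ≤
      {x | x ∈ L ∧ x ∈ Submodule.span ℝ (range u) ∧ ‖x‖ ≤ R + ∑ i, ‖u i‖}.ncard *
        ENNReal.ofReal σ ^ k := by
  set S := Submodule.span ℝ (range u) with hS
  have hfin : {x | x ∈ L ∧ x ∈ S ∧ ‖x‖ ≤ R + ∑ i, ‖u i‖}.Finite :=
    (hL (R + ∑ i, ‖u i‖)).subset fun x hx => ⟨hx.1, hx.2.2⟩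
  have hsub : φ '' {x | x ∈ S ∧ ‖x‖ ≤ R} ⊆
      ⋃ y ∈ hfin.toFinset, Icc (φ y) (φ y + fun _ => σ) := by
    rintro _ ⟨x, ⟨hxS, hxR⟩, rfl⟩
    obtain ⟨t, rfl⟩ := (Submodule.mem_span_range_iff_exists_fun ℝ).1 hxS
    have hdec : ∑ i, t i • u i = ∑ i, ⌊t i⌋ • u i + ∑ i, Int.fract (t i) • u i := by
      rw [← Finset.sum_add_distrib]
      refine Finset.sum_congr rfl fun i _ => ?_
      rw [← Int.cast_smul_eq_zsmul ℝ, ← add_smul, Int.floor_add_fract]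
    have hn : ‖∑ i, Int.fract (t i) • u i‖ ≤ ∑ i, ‖u i‖ := by
      refine norm_sum_le_of_le _ fun i _ => ?_
      rw [norm_smul, Real.norm_of_nonneg (Int.fract_nonneg _)]
      exact mul_le_of_le_one_left (norm_nonneg _) (Int.fract_lt_one _).le
    simp only [mem_iUnion]
    refine ⟨∑ i, ⌊t i⌋ • u i, ?_, ?_⟩
    · rw [Set.Finite.mem_toFinset]
      refine ⟨L.sum_mem fun i _ => L.zsmul_mem (hu i) _, S.sum_mem fun i _ =>
        S.smul_of_tower_mem _ (Submodule.subset_span ⟨i, rfl⟩), ?_⟩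
      rw [eq_sub_of_add_eq hdec.symm]
      exact (norm_sub_le _ _).trans (add_le_add hxR hn)
    · have hv : φ (∑ i, Int.fract (t i) • u i) = fun i => Int.fract (t i) * s i := by
        ext j
        simp [map_sum, hφ, Pi.single_apply]
      rw [hdec, map_add, hv]
      constructor
      · intro j
        simp only [Pi.add_apply]
        have := mul_nonneg (Int.fract_nonneg (t j)) (hs0 j)
        linarith
      · intro j
        simp only [Pi.add_apply]
        have := mul_le_of_le_one_left (hs0 j) (Int.fract_lt_one (t j)).le
        linarith [hs j]
  refine (measure_mono hsub).trans ((measure_biUnion_finset_le _ _).trans ?_)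
  simp only [Real.volume_Icc_pi, Pi.add_apply, add_sub_cancel_left, Finset.prod_const,
    Finset.card_univ, Fintype.card_fin, Finset.sum_const, nsmul_eq_mul]
  rw [ncard_eq_toFinset_card _ hfin]

/-- The image in `ℝ ^ k` of the short vectors of a lattice of rank `k + d` containing short
multiples of the coordinate directions is covered by the sum of a `d`-dimensional progression
and a parallelotope. -/
theorem exists_symGAP_add_parallelotope (k d : ℕ) :
    ∃ R : ℝ, 0 ≤ R ∧ ∀ (E : Type) [NormedAddCommGroup E] [NormedSpace ℝ E] [FiniteDimensional ℝ E]
      (L : AddSubgroup E), Module.finrank ℝ E = k + d → FiniteBalls L →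
      ∀ (φ : E →ₗ[ℝ] (Fin k → ℝ)) (u : Fin k → E) (s : Fin k → ℝ) (τ σ : ℝ),
      (∀ i, u i ∈ L) → (∀ i, ‖u i‖ ≤ 2) → 0 < τ → (∀ i, τ ≤ s i) → (∀ i, s i ≤ σ) →
      (∀ i, φ (u i) = Pi.single i (s i)) →
      ∃ (b : Fin d → Fin k → ℝ) (g : Fin d → ℕ) (v : Fin k → Fin k → ℝ),
        (Matrix.of v).det ≠ 0 ∧
        (∀ x ∈ L, ‖x‖ ≤ 2 → ∃ y ∈ symGAP b g, ∃ r : Fin k → ℝ, (∀ i, |r i| ≤ 1) ∧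
          φ x = y + ∑ i, r i • v i) ∧
        (∀ x : Fin k → ℝ, (∀ i, |x i| ≤ τ) → ∃ r : Fin k → ℝ, (∀ i, |r i| ≤ 1) ∧
          x = ∑ i, r i • v i) ∧
        ((∏ i, (2 * g i + 1) : ℕ) : ℝ≥0∞) * ENNReal.ofReal |(Matrix.of v).det| ≤
          k ^ k * (ballCount L R * ENNReal.ofReal σ ^ k) := by
  obtain ⟨C, hC, H⟩ := exists_symGAP_of_ball d
  set R₁ : ℝ := 2 + d * (C * 2 + 1) + 2 * k with hR₁
  have hR₁0 : 0 ≤ R₁ := by positivity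
  refine ⟨C * 2 + 1 + 2⁻¹ * (2 * k) + (R₁ + 2 * k), by positivity, ?_⟩
  intro E _ _ _ L hE hL φ u s τ σ hu hu2 hτ hsτ hsσ hφ
  have hs0 : ∀ i, 0 < s i := fun i => hτ.trans_le (hsτ i)
  have husum : ∑ i, ‖u i‖ ≤ 2 * k := by
    refine (Finset.sum_le_sum fun i _ => hu2 i).trans ?_
    simp [mul_comm]
  have hφsum : ∀ t : Fin k → ℝ, φ (∑ i, t i • u i) = fun i => t i * s i := by
    intro t
    ext j
    simp [map_sum, hφ, Pi.single_apply]
  have hlin : LinearIndependent ℝ u := by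
    refine Fintype.linearIndependent_iff.2 fun t ht i => ?_
    have h1 := hφsum t
    rw [ht, map_zero] at h1
    have h2 := congrFun h1 i
    simpa [(hs0 i).ne'] using h2.symm
  set S := Submodule.span ℝ (range u) with hS
  have hSc : IsClosed (S : Set E) := S.closed_of_finiteDimensional
  have hSrank : Module.finrank ℝ S = k := by
    rw [hS, finrank_span_eq_card hlin, Fintype.card_fin]
  have hQrank : Module.finrank ℝ (E ⧸ S) ≤ d := by
    have := Submodule.finrank_quotient_add_finrank S
    omega
  obtain ⟨w, g, hsub, hball, hprod⟩ := H (E ⧸ S) (L.map S.mkQ.toAddMonoidHom) hQrank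
    (hL.map_mkQ u hu) 2 (by norm_num)
  have hlift : ∀ i, ∃ x : E, S.mkQ x = w i ∧ ‖(g i : ℝ) • x‖ ≤ C * 2 + 1 := by
    intro i
    rcases Nat.eq_zero_or_pos (g i) with h0 | hpos
    · obtain ⟨x, hx⟩ := S.mkQ_surjective (w i)
      exact ⟨x, hx, by rw [h0]; simp; positivity⟩
    · have hg : (0 : ℝ) < g i := by exact_mod_cast hpos
      have hmem : (g i : ℝ) • w i ∈ symGAP w g := by
        refine ⟨Pi.single i (g i), fun j => ?_, ?_⟩
        · by_cases hj : j = i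
          · subst hj; simp
          · simp [hj]
        · rw [Finset.sum_eq_single i]
          · simp [Nat.cast_smul_eq_nsmul]
          · intro j _ hj; simp [hj]
          · simp
      obtain ⟨m, hm, hmn⟩ := Submodule.Quotient.norm_mk_lt (S := S) ((g i : ℝ) • w i)
        (ε := 1) one_pos
      have hle := (hball hmem).2
      refine ⟨(g i : ℝ)⁻¹ • m, ?_, ?_⟩
      · rw [map_smul, Submodule.mkQ_apply, hm, smul_smul, inv_mul_cancel₀ hg.ne', one_smul]
      · rw [smul_smul, mul_inv_cancel₀ hg.ne', one_smul]
        linarith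
  choose W hWw hWn using hlift
  set B := φ '' {x | x ∈ S ∧ ‖x‖ ≤ R₁} with hB
  have hBset : {x | x ∈ S ∧ ‖x‖ ≤ R₁} = (S : Set E) ∩ Metric.closedBall 0 R₁ := by
    ext x; simp
  have hcompact : IsCompact B := by
    rw [hB, hBset]
    exact ((isCompact_closedBall (0 : E) R₁).inter_left S.closed_of_finiteDimensional).image
      φ.continuous_of_finiteDimensional
  have hconvex : Convex ℝ B := by
    rw [hB, hBset]
    exact (S.convex.inter (convex_closedBall _ _)).linear_image φ
  have h0B : (0 : Fin k → ℝ) ∈ B := ⟨0, ⟨S.zero_mem, by simpa using hR₁0⟩, map_zero φ⟩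
  have huS : ∀ i, u i ∈ S := fun i => Submodule.subset_span ⟨i, rfl⟩
  have huR : 2 * (k : ℝ) ≤ R₁ := by
    have : 0 ≤ (d : ℝ) * (C * 2 + 1) := by positivity
    linarith
  have hcube : ∀ x : Fin k → ℝ, (∀ i, |x i| ≤ s i) → x ∈ B := by
    intro x hx
    refine ⟨∑ i, (x i / s i) • u i, ⟨S.sum_mem fun i _ => S.smul_mem _ (huS i), ?_⟩, ?_⟩
    · refine (norm_sum_le_of_le _ (fun i _ => ?_)).trans (husum.trans huR)
      rw [norm_smul, Real.norm_eq_abs, abs_div, abs_of_pos (hs0 i)]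
      exact mul_le_of_le_one_left (norm_nonneg _) ((div_le_one (hs0 i)).2 (hx i))
    · rw [hφsum]
      ext i
      exact div_mul_cancel₀ _ (hs0 i).ne'
  obtain ⟨v, hvdet, hBv, hvol⟩ := exists_parallelotope_of_convex hcompact hconvex h0B
    (w := fun i => Pi.single i (s i)) (fun i => hcube _ fun j => by
      by_cases hj : j = i
      · subst hj; simp [abs_of_pos (hs0 j)]
      · simp [hj, (hs0 j).le]) (by
      have : Matrix.of (fun i => Pi.single i (s i)) = Matrix.diagonal s := by
        ext i j
        simp [Matrix.diagonal_apply, Pi.single_apply, eq_comm]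
      rw [this, Matrix.det_diagonal]
      exact Finset.prod_ne_zero_iff.2 fun i _ => (hs0 i).ne')
  refine ⟨fun i => φ (W i), g, v, hvdet, fun x hx hx2 => ?_, fun x hx => ?_, ?_⟩
  · have hxQ : S.mkQ x ∈ symGAP w g :=
      hsub ⟨⟨x, hx, rfl⟩, (Submodule.Quotient.norm_mk_le _ x).trans hx2⟩
    obtain ⟨c, hc, hcx⟩ := hxQ
    have hnorm : ‖∑ i, c i • W i‖ ≤ d * (C * 2 + 1) := by
      refine (norm_sum_le_of_le (f := fun i => c i • W i) (n := fun _ => C * 2 + 1) _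
        fun i _ => ?_).trans (by simp [mul_add])
      refine le_trans ?_ (hWn i)
      rw [← Int.cast_smul_eq_zsmul ℝ, norm_smul, norm_smul]
      refine mul_le_mul_of_nonneg_right ?_ (norm_nonneg _)
      rw [Real.norm_eq_abs, Real.norm_natCast]
      exact_mod_cast hc i
    have hmem : x - ∑ i, c i • W i ∈ S := by
      rw [← Submodule.ker_mkQ S, LinearMap.mem_ker, map_sub, hcx, map_sum]
      simp [hWw]
    obtain ⟨r, hr, hrx⟩ := hBv (φ (x - ∑ i, c i • W i)) ⟨_, ⟨hmem, by
      refine (norm_sub_le _ _).trans ?_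
      have : (0 : ℝ) ≤ 2 * k := by positivity
      linarith⟩, rfl⟩
    refine ⟨_, ⟨c, hc, rfl⟩, r, hr, ?_⟩
    rw [← hrx, map_sub, map_sum]
    simp
  · exact hBv x (hcube x fun i => (hx i).trans (hsτ i))
  · set N := {x | x ∈ L ∧ x ∈ S ∧ ‖x‖ ≤ R₁ + ∑ i, ‖u i‖}.ncard with hN
    have h1 : volume B ≤ N * ENNReal.ofReal σ ^ k :=
      volume_image_ball_le hL u hu φ s (fun i => (hs0 i).le) hsσ hφ R₁
    have h2 : (∏ i, (2 * g i + 1)) * N ≤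
        ballCount L (C * 2 + 1 + 2⁻¹ * (2 * k) + (R₁ + 2 * k)) := by
      have h3 : ∏ i, (2 * g i + 1) ≤ ballCount (L.map S.mkQ.toAddMonoidHom) (C * 2) := by
        exact_mod_cast hprod
      refine (Nat.mul_le_mul_right N h3).trans
        ((ballCount_map_mkQ_mul_le hL u hu _ _).trans (ballCount_mono hL ?_))
      gcongr
    calc ((∏ i, (2 * g i + 1) : ℕ) : ℝ≥0∞) * ENNReal.ofReal |(Matrix.of v).det|
        ≤ (∏ i, (2 * g i + 1) : ℕ) * (k ^ k * (N * ENNReal.ofReal σ ^ k)) := by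
          gcongr
          exact hvol.trans (by gcongr)
      _ = k ^ k * (((∏ i, (2 * g i + 1)) * N : ℕ) * ENNReal.ofReal σ ^ k) := by
          push_cast; ring
      _ ≤ _ := by gcongr

/-- The cell with index `z` of the cubic grid with side `s`. -/
def gridCell {k : ℕ} (s : ℝ) (z : Fin k → ℤ) : Set (Fin k → ℝ) :=
  Set.univ.pi fun i => Ico (s * z i) (s * z i + s)

theorem mem_gridCell {k : ℕ} {s : ℝ} (hs : 0 < s) {z : Fin k → ℤ} {p : Fin k → ℝ} :
    p ∈ gridCell s z ↔ ∀ i, ⌊p i / s⌋ = z i := by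
  simp only [gridCell, mem_univ_pi, mem_Ico, Int.floor_eq_iff]
  refine forall_congr' fun i => ?_
  rw [le_div_iff₀ hs, div_lt_iff₀ hs, add_mul, one_mul, mul_comm s]

theorem volume_gridCell {k : ℕ} (s : ℝ) (z : Fin k → ℤ) :
    volume (gridCell s z) = ENNReal.ofReal s ^ k := by
  simp [gridCell, volume_pi_pi]

theorem volume_biUnion_gridCell {k : ℕ} {s : ℝ} (hs : 0 < s) (F : Finset (Fin k → ℤ)) :
    volume (⋃ z ∈ F, gridCell s z) = F.card * ENNReal.ofReal s ^ k := by
  rw [measure_biUnion_finset]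
  · simp [volume_gridCell]
  · intro z _ z' _ hzz'
    refine Set.disjoint_left.2 fun p hp hp' => hzz' ?_
    ext i
    rw [← (mem_gridCell hs).1 hp i, (mem_gridCell hs).1 hp' i]
  · exact fun z _ => MeasurableSet.univ_pi fun i => measurableSet_Ico

/-- A compact set is covered by the cells of a fine grid, indexed by a set of integer vectors
containing long segments in all coordinate directions, whose sumset is not much larger than that
of the compact set. -/
theorem exists_grid_cover {k : ℕ} {K : Set (Fin k → ℝ)} (hK : IsCompact K) (hne : K.Nonempty)
    {V : ℝ≥0∞} (hV : volume (K + K) < V) (M : ℕ) (hM : 1 ≤ M) :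
    ∃ (s : ℝ) (F : Finset (Fin k → ℤ)), 0 < s ∧ K ⊆ (⋃ z ∈ F, gridCell s z) ∧
      (F + F).card * ENNReal.ofReal s ^ k ≤ V ∧
      ∃ t : Fin k → ℤ, t ∈ F ∧ ∀ i, ∀ j : ℕ, j < M → t + Pi.single i (j : ℤ) ∈ F := by
  obtain ⟨δ, hδV, hδ⟩ : ∃ δ : ℝ, volume (Metric.cthickening δ (K + K)) < V ∧ 0 < δ := by
    have h1 := (tendsto_measure_cthickening_of_isCompact (μ := volume)
      (hK.add hK)).eventually_lt_const hV
    have h2 : ∀ᶠ δ : ℝ in nhdsWithin 0 (Ioi 0), volume (Metric.cthickening δ (K + K)) < V :=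
      h1.filter_mono nhdsWithin_le_nhds
    exact (h2.and self_mem_nhdsWithin).exists
  have hM' : (1 : ℝ) ≤ M := by exact_mod_cast hM
  set s : ℝ := δ / (2 * M + 1) with hs
  have hs0 : 0 < s := by positivity
  have hsδ : s * (2 * M + 1) = δ := div_mul_cancel₀ _ (by positivity)
  set G : Set (Fin k → ℤ) := {z | ∃ x ∈ K, ∀ i, ⌊x i / s⌋ ≤ z i ∧ z i < ⌊x i / s⌋ + M} with hG
  have hfin : G.Finite := by
    obtain ⟨R, hR⟩ := hK.isBounded.exists_norm_le
    refine (Set.finite_Icc (fun _ : Fin k => ⌊-R / s⌋) (fun _ => ⌊R / s⌋ + M)).subset ?_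
    rintro z ⟨x, hx, hz⟩
    have hxi : ∀ i, |x i| ≤ R := fun i => (norm_le_pi_norm x i).trans (hR x hx)
    refine ⟨fun i => le_trans (Int.floor_mono ?_) (hz i).1, fun i => (hz i).2.le.trans
      (add_le_add_left (Int.floor_mono ?_) _)⟩
    · exact div_le_div_of_nonneg_right (abs_le.1 (hxi i)).1 hs0.le
    · exact div_le_div_of_nonneg_right (abs_le.1 (hxi i)).2 hs0.le
  have hmemF : ∀ z, z ∈ hfin.toFinset ↔ z ∈ G := fun z => hfin.mem_toFinset
  have happrox : ∀ z ∈ G, ∃ x ∈ K, ∀ i, |s * z i - x i| ≤ s * M := by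
    rintro z ⟨x, hx, hz⟩
    refine ⟨x, hx, fun i => ?_⟩
    have h1 := Int.floor_le (x i / s)
    have h2 := Int.lt_floor_add_one (x i / s)
    rw [le_div_iff₀ hs0] at h1
    rw [div_lt_iff₀ hs0] at h2
    have h3 : (⌊x i / s⌋ : ℝ) ≤ z i := by exact_mod_cast (hz i).1
    have h4 : (z i : ℝ) < ⌊x i / s⌋ + M := by exact_mod_cast (hz i).2
    rw [abs_le]
    constructor <;> nlinarith
  refine ⟨s, hfin.toFinset, hs0, fun x hx => ?_, ?_, ?_⟩
  · simp only [mem_iUnion]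
    exact ⟨fun i => ⌊x i / s⌋, (hmemF _).2 ⟨x, hx, fun i => ⟨le_rfl, by simp; omega⟩⟩,
      (mem_gridCell hs0).2 fun i => rfl⟩
  · rw [← volume_biUnion_gridCell hs0]
    refine le_trans (measure_mono ?_) hδV.le
    intro p hp
    simp only [mem_iUnion] at hp
    obtain ⟨z, hz, hpz⟩ := hp
    obtain ⟨z₁, hz₁, z₂, hz₂, rfl⟩ := Finset.mem_add.1 hz
    obtain ⟨x₁, hx₁, h₁⟩ := happrox z₁ ((hmemF _).1 hz₁)
    obtain ⟨x₂, hx₂, h₂⟩ := happrox z₂ ((hmemF _).1 hz₂)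
    refine Metric.mem_cthickening_of_dist_le p (x₁ + x₂) δ _ (add_mem_add hx₁ hx₂) ?_
    rw [dist_pi_le_iff hδ.le]
    intro i
    have h3 := hpz i trivial
    simp only [Pi.add_apply, Int.cast_add, mem_Ico] at h3
    have h4 := abs_le.1 (h₁ i)
    have h5 := abs_le.1 (h₂ i)
    rw [Real.dist_eq, Pi.add_apply, abs_le, ← hsδ]
    constructor <;> nlinarith
  · obtain ⟨x, hx⟩ := hne
    refine ⟨fun i => ⌊x i / s⌋, (hmemF _).2 ⟨x, hx, fun i => ⟨le_rfl, by simp; omega⟩⟩,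
      fun i j hj => (hmemF _).2 ⟨x, hx, fun i' => ?_⟩⟩
    by_cases hi : i' = i
    · subst hi; simp; omega
    · simp [hi]; omega

/-- Covering lemma: a set with small sumset is covered by few translates of a difference set. -/
theorem exists_cover_sub_of_volume_add_le {k : ℕ} {A K : Set (Fin k → ℝ)} (hK : MeasurableSet K)
    (hKA : K ⊆ A) (hK0 : volume K ≠ 0) (hKtop : volume K ≠ ⊤) {D : ℝ} (hD : 0 ≤ D)
    (h : volume (A + A) ≤ ENNReal.ofReal D * volume K) :
    ∃ Y : Finset (Fin k → ℝ), (Y.card : ℝ) ≤ D ∧ A ⊆ (Y : Set (Fin k → ℝ)) + (K - K) := by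
  classical
  set good : Finset (Fin k → ℝ) → Prop := fun Y => (Y : Set (Fin k → ℝ)) ⊆ A ∧
    (Y : Set (Fin k → ℝ)).PairwiseDisjoint fun y => y +ᵥ K with hgood
  have hbound : ∀ Y, good Y → (Y.card : ℝ) ≤ D := by
    rintro Y ⟨hYA, hdisj⟩
    have h1 : volume (⋃ y ∈ Y, (y +ᵥ K : Set (Fin k → ℝ))) = Y.card * volume K := by
      rw [measure_biUnion_finset hdisj fun y _ => hK.const_vadd y]
      simp [measure_vadd]
    have h2 : (⋃ y ∈ Y, (y +ᵥ K : Set (Fin k → ℝ))) ⊆ A + A := by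
      intro x hx
      simp only [mem_iUnion] at hx
      obtain ⟨y, hy, z, hz, rfl⟩ := hx
      exact add_mem_add (hYA hy) (hKA hz)
    have h3 := (measure_mono (μ := volume) h2).trans h
    rw [h1, ENNReal.mul_le_mul_iff_left hK0 hKtop, ← ENNReal.ofReal_natCast,
      ENNReal.ofReal_le_ofReal_iff hD] at h3
    exact h3
  have hb : ∀ n, (∃ Y, good Y ∧ Y.card = n) → n ≤ ⌊D⌋₊ := by
    rintro n ⟨Y, hY, rfl⟩
    exact Nat.le_floor (hbound Y hY)
  obtain ⟨Y, hY, hYc⟩ := Nat.findGreatest_spec (P := fun n => ∃ Y, good Y ∧ Y.card = n)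
    (hb 0 ⟨∅, ⟨by simp, by simp⟩, rfl⟩) ⟨∅, ⟨by simp, by simp⟩, rfl⟩
  refine ⟨Y, hbound Y hY, fun x hx => ?_⟩
  by_contra hxn
  have hdx : ∀ y ∈ Y, Disjoint (x +ᵥ K : Set (Fin k → ℝ)) (y +ᵥ K) := by
    intro y hy
    refine Set.disjoint_left.2 ?_
    rintro _ ⟨a, ha, rfl⟩ ⟨b, hb, hab⟩
    refine hxn ⟨y, hy, b - a, sub_mem_sub hb ha, ?_⟩
    simp only [vadd_eq_add] at hab ⊢
    rw [← add_sub_assoc, hab, add_sub_cancel_right]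
  have hxY : x ∉ Y := by
    intro hxY
    obtain ⟨a, ha⟩ := nonempty_of_measure_ne_zero hK0
    exact hxn ⟨x, hxY, a - a, sub_mem_sub ha ha, by simp⟩
  have hins : good (insert x Y) := by
    refine ⟨?_, ?_⟩
    · rw [Finset.coe_insert]
      exact insert_subset hx hY.1
    · rw [Finset.coe_insert]
      exact hY.2.insert fun y hy _ => hdx y hy
  have hle := Nat.le_findGreatest (P := fun n => ∃ Y, good Y ∧ Y.card = n)
    (hb (Y.card + 1) ⟨_, hins, Finset.card_insert_of_notMem hxY⟩)
    ⟨_, hins, Finset.card_insert_of_notMem hxY⟩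
  omega

/-- A generic small perturbation in a fixed direction makes a progression proper. -/
theorem exists_proper_perturbation {k d : ℕ} (b : Fin d → Fin k → ℝ) (g : Fin d → ℕ)
    {v₀ : Fin k → ℝ} (hv₀ : v₀ ≠ 0) :
    ∃ b' : Fin d → Fin k → ℝ,
      (∀ c : Fin d → ℤ, (∀ i, |c i| ≤ (2 * g i : ℕ)) → ∑ i, c i • b' i = 0 → c = 0) ∧
      ∀ y ∈ symGAP b g, ∃ y' ∈ symGAP b' g, ∃ ρ : ℝ, |ρ| ≤ 1 ∧ y = y' + ρ • v₀ := by
  obtain ⟨j, hj⟩ := Function.ne_iff.1 hv₀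
  rw [Pi.zero_apply] at hj
  set p : (Fin d → ℤ) → Polynomial ℝ := fun c => Polynomial.C ((∑ i, c i • b i) j) +
    ∑ i : Fin d, Polynomial.C ((c i : ℝ) * v₀ j) * Polynomial.X ^ ((i : ℕ) + 1) with hp
  have hp0 : ∀ c, c ≠ 0 → p c ≠ 0 := by
    intro c hc h0
    obtain ⟨i, hi⟩ := Function.ne_iff.1 hc
    have h1 : (p c).coeff ((i : ℕ) + 1) = (c i : ℝ) * v₀ j := by
      simp only [hp, Polynomial.coeff_add, Polynomial.finsetSum_coeff, Polynomial.coeff_C_mul,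
        Polynomial.coeff_X_pow, Polynomial.coeff_C_succ, zero_add]
      rw [Finset.sum_eq_single i]
      · simp
      · intro i' _ hi'
        have : ¬ ((i : ℕ) + 1 = i' + 1) := fun h => hi' (Fin.ext (by omega))
        simp only [this, if_false, mul_zero]
      · simp
    rw [h0, Polynomial.coeff_zero] at h1
    exact mul_ne_zero (by exact_mod_cast hi) hj h1.symm
  set bad : Set ℝ := ⋃ c ∈ (intBox fun i => 2 * g i).erase 0, {t | (p c).IsRoot t} with hbad
  have hbadfin : bad.Finite := by
    refine Set.Finite.biUnion (Finset.finite_toSet _) fun c hc => ?_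
    exact Polynomial.finite_setOfPred_isRoot (hp0 c (Finset.ne_of_mem_erase hc))
  have hT : (0 : ℝ) < 1 / (1 + ∑ i, (g i : ℝ)) := by positivity
  obtain ⟨t, ⟨ht0, htT⟩, htbad⟩ := ((Ioo_infinite hT).sdiff hbadfin).nonempty
  have hsum : (0 : ℝ) ≤ ∑ i, (g i : ℝ) := by positivity
  rw [lt_div_iff₀ (by positivity)] at htT
  have ht1 : t ≤ 1 := by nlinarith
  have hexp : ∀ c : Fin d → ℤ, ∑ i, c i • (b i + t ^ ((i : ℕ) + 1) • v₀) =
      ∑ i, c i • b i + (∑ i, (c i : ℝ) * t ^ ((i : ℕ) + 1)) • v₀ := by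
    intro c
    rw [Finset.sum_smul, ← Finset.sum_add_distrib]
    refine Finset.sum_congr rfl fun i _ => ?_
    rw [smul_add, ← Int.cast_smul_eq_zsmul ℝ (c i) (t ^ _ • v₀), smul_smul]
  refine ⟨fun i => b i + t ^ ((i : ℕ) + 1) • v₀, fun c hc h0 => ?_, ?_⟩
  · by_contra hc0
    refine htbad ?_
    simp only [hbad, mem_iUnion]
    refine ⟨c, Finset.mem_erase.2 ⟨hc0, mem_intBox.2 hc⟩, ?_⟩
    rw [hexp] at h0
    have h1 := congrFun h0 j
    rw [Pi.add_apply, Pi.smul_apply, Pi.zero_apply, smul_eq_mul, Finset.sum_mul] at h1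
    change (p c).eval t = 0
    rw [← h1]
    simp only [hp, Polynomial.eval_add, Polynomial.eval_C, Polynomial.eval_finsetSum,
      Polynomial.eval_mul, Polynomial.eval_pow, Polynomial.eval_X]
    congr 1
    exact Finset.sum_congr rfl fun i _ => by ring
  · rintro _ ⟨c, hc, rfl⟩
    refine ⟨_, ⟨c, hc, rfl⟩, -∑ i, (c i : ℝ) * t ^ ((i : ℕ) + 1), ?_, ?_⟩
    · rw [abs_neg]
      calc |∑ i, (c i : ℝ) * t ^ ((i : ℕ) + 1)| ≤ ∑ i, (g i : ℝ) * t := by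
            refine (Finset.abs_sum_le_sum_abs _ _).trans (Finset.sum_le_sum fun i _ => ?_)
            rw [abs_mul, abs_of_pos (pow_pos ht0 _)]
            have h1 : |(c i : ℝ)| ≤ g i := by exact_mod_cast hc i
            have h2 : t ^ ((i : ℕ) + 1) ≤ t := pow_le_of_le_one ht0.le ht1 (by omega)
            exact mul_le_mul h1 h2 (by positivity) (by positivity)
        _ ≤ 1 := by rw [← Finset.sum_mul]; nlinarith
    · rw [hexp, neg_smul, add_neg_cancel_right]

/-- The embedding of the integer lattice with mesh `s`. -/
noncomputable def gridHom (k : ℕ) (s : ℝ) : (Fin k → ℤ) →+ (Fin k → ℝ) where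
  toFun z i := s * z i
  map_zero' := by ext; simp
  map_add' z z' := by ext; simp [mul_add]

theorem gridHom_apply {k : ℕ} (s : ℝ) (z : Fin k → ℤ) (i : Fin k) :
    gridHom k s z i = s * z i := rfl

theorem gridHom_injective (k : ℕ) {s : ℝ} (hs : 0 < s) : Function.Injective (gridHom k s) := by
  intro z z' h
  ext i
  have h1 := congrFun h i
  rw [gridHom_apply, gridHom_apply] at h1
  exact_mod_cast mul_left_cancel₀ hs.ne' h1

/-- The structure of the difference set of a compact set with small doubling. -/
theorem exists_cover_sub_of_isCompact (k d : ℕ) {ε : ℝ} (hε : 0 < ε) (hε' : ε < 2 ^ (k + d + 1)) :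
    ∃ C : ℝ, 0 ≤ C ∧ ∀ K : Set (Fin k → ℝ), IsCompact K → volume K ≠ 0 →
      volume (K + K) < ENNReal.ofReal (2 ^ (k + d + 1) - ε) * volume K →
      ∃ (Z : Finset (Fin k → ℝ)) (b : Fin d → Fin k → ℝ) (g : Fin d → ℕ) (v : Fin k → Fin k → ℝ),
        (Z.card : ℝ) ≤ C ∧ (Matrix.of v).det ≠ 0 ∧
        (∀ x ∈ K - K, ∃ z ∈ Z, ∃ y ∈ symGAP b g, ∃ r : Fin k → ℝ, (∀ i, |r i| ≤ 2) ∧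
          x = z + y + ∑ i, r i • v i) ∧
        ((∏ i, (2 * g i + 1) : ℕ) : ℝ≥0∞) * ENNReal.ofReal |(Matrix.of v).det| ≤
          ENNReal.ofReal C * volume K := by
  classical
  obtain ⟨C₁, HC₁⟩ := exists_hasCover_rank (k + d) hε
  obtain ⟨R, hR, HR⟩ := exists_symGAP_add_parallelotope k d
  set C₀ := max C₁ 0 with hC₀
  have hC₀0 : 0 ≤ C₀ := le_max_right _ _
  set M := ⌊C₀⌋₊ + 1 with hM
  set D : ℝ := 2 ^ (k + d + 1) - ε with hD
  have hD0 : 0 ≤ D := by rw [hD]; linarith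
  set B : ℝ := (R + 1) ^ (k + d) * (3 ^ (k + d) * C₀) with hB
  have hB0 : 0 ≤ B := by positivity
  clear_value B
  refine ⟨max (C₀ * C₀) (k ^ k * (B * M ^ k * D)), le_max_of_le_left (by positivity),
    fun K hK hK0 hKK => ?_⟩
  obtain ⟨s, F, hs, hKF, hFF, t, ht, htF⟩ := exists_grid_cover hK
    (nonempty_of_measure_ne_zero hK0) hKK M (by omega)
  have hs' : ENNReal.ofReal s ^ k ≠ 0 := pow_ne_zero _ (by simpa using hs)
  have hs'' : ENNReal.ofReal s ^ k ≠ ⊤ := ENNReal.pow_ne_top ENNReal.ofReal_ne_top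
  have hKle : volume K ≤ F.card * ENNReal.ofReal s ^ k := by
    rw [← volume_biUnion_gridCell hs]
    exact measure_mono hKF
  have hdoub : ((F + F).card : ℝ) ≤ D * F.card := by
    have h1 : ((F + F).card : ℝ≥0∞) * ENNReal.ofReal s ^ k ≤
        (ENNReal.ofReal D * F.card) * ENNReal.ofReal s ^ k := by
      rw [mul_assoc]
      exact hFF.trans (by gcongr)
    rw [ENNReal.mul_le_mul_iff_left hs' hs'', ← ENNReal.ofReal_natCast, ← ENNReal.ofReal_natCast,
      ← ENNReal.ofReal_mul hD0, ENNReal.ofReal_le_ofReal_iff (by positivity)] at h1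
    exact h1
  obtain ⟨a, h, X, hX, hcov, hprod⟩ := HC₁ k (Fin k → ℝ) (gridHom k s) (gridHom_injective k hs) F
    ⟨t, ht⟩ hdoub
  have hX₀ : (X.card : ℝ) ≤ C₀ := hX.trans (le_max_left _ _)
  rw [Finset.card_image_of_injective _ (gridHom_injective k hs)] at hprod
  set h' : Fin (k + d) → ℕ := fun i => h i + 1 with hh'
  have hh'0 : ∀ i, 0 < h' i := fun i => Nat.succ_pos _
  set L := (boxVec h').range with hLdef
  have hL : FiniteBalls L := finiteBalls_boxVec hh'0
  set φ := boxMap a h' with hφ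
  have hlift : ∀ z ∈ F, ∃ x ∈ X, ∃ e ∈ L, ‖e‖ ≤ 1 ∧ gridHom k s z = x + φ e := by
    intro z hz
    obtain ⟨x, hx, _, ⟨c, hc, rfl⟩, hxc⟩ := hcov (Finset.mem_image_of_mem (gridHom k s) hz)
    refine ⟨x, hx, boxVec h' c, ⟨c, rfl⟩, (boxVec_norm_le hh'0 zero_le_one c).2 fun i => ?_, ?_⟩
    · have h1 : (|c i| : ℝ) ≤ h i := by exact_mod_cast hc i
      rw [hh', one_mul]
      push_cast
      linarith
    · rw [hφ, boxMap_boxVec a hh'0]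
      exact hxc.symm
  choose! x hx e heL he1 hxe using hlift
  have hu : ∀ i, ∃ (u : Fin (k + d) → ℝ) (m : ℕ), u ∈ L ∧ ‖u‖ ≤ 2 ∧ 1 ≤ m ∧ m ≤ M ∧
      φ u = Pi.single i (s * m) := by
    intro i
    have hcard : X.card < (Finset.range M).card := by
      rw [Finset.card_range, hM]
      have : X.card ≤ ⌊C₀⌋₊ := Nat.le_floor hX₀
      omega
    obtain ⟨j₁, hj₁, j₂, hj₂, hne, heq⟩ := Finset.exists_ne_map_eq_of_card_lt_of_maps_to hcard
      (f := fun j => x (t + Pi.single i (j : ℤ)))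
      (fun j hj => hx _ (htF i j (Finset.mem_range.1 hj)))
    wlog hlt : j₁ < j₂ generalizing j₁ j₂
    · exact this j₂ hj₂ j₁ hj₁ hne.symm heq.symm (by omega)
    have hF₁ := htF i j₁ (Finset.mem_range.1 hj₁)
    have hF₂ := htF i j₂ (Finset.mem_range.1 hj₂)
    have hj₂M := Finset.mem_range.1 hj₂
    refine ⟨e (t + Pi.single i (j₂ : ℤ)) - e (t + Pi.single i (j₁ : ℤ)), j₂ - j₁,
      L.sub_mem (heL _ hF₂) (heL _ hF₁), ?_, by omega, by omega, ?_⟩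
    · refine (norm_sub_le _ _).trans ?_
      linarith [he1 _ hF₁, he1 _ hF₂]
    · have h1 := hxe _ hF₁
      have h2 := hxe _ hF₂
      have h3 : φ (e (t + Pi.single i (j₂ : ℤ)) - e (t + Pi.single i (j₁ : ℤ))) =
          gridHom k s (t + Pi.single i (j₂ : ℤ)) - gridHom k s (t + Pi.single i (j₁ : ℤ)) := by
        rw [map_sub, h1, h2, heq, add_sub_add_left_eq_sub]
      rw [h3]
      ext i'
      rw [Pi.sub_apply, gridHom_apply, gridHom_apply]
      by_cases hi : i' = i
      · subst hi
        simp only [Pi.add_apply, Pi.single_eq_same]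
        rw [Nat.cast_sub hlt.le]
        push_cast
        ring
      · simp [hi]
  choose u m huL hu2 hm1 hmM hφu using hu
  have hdim : Module.finrank ℝ (Fin (k + d) → ℝ) = k + d := Module.finrank_fin_fun ℝ
  obtain ⟨b, g, v, hv, hcovL, hcovs, hvol⟩ := HR _ L hdim hL φ u (fun i => s * m i) s (s * M) huL
    hu2 hs (fun i => le_mul_of_one_le_right hs.le (by exact_mod_cast hm1 i))
    (fun i => mul_le_mul_of_nonneg_left (by exact_mod_cast hmM i) hs.le) hφu
  refine ⟨X - X, b, g, v, ?_, hv, ?_, ?_⟩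
  · refine le_trans ?_ (le_max_left _ _)
    have h1 : ((X - X).card : ℝ) ≤ X.card * X.card := by exact_mod_cast Finset.card_sub_le
    exact h1.trans (mul_le_mul hX₀ hX₀ (by positivity) hC₀0)
  · rintro _ ⟨p, hp, q, hq, rfl⟩
    have hp' := hKF hp
    have hq' := hKF hq
    simp only [mem_iUnion] at hp' hq'
    obtain ⟨z, hz, hpz⟩ := hp'
    obtain ⟨z', hz', hqz⟩ := hq'
    obtain ⟨y, hy, r, hr, hyr⟩ := hcovL (e z - e z') (L.sub_mem (heL z hz) (heL z' hz'))
      ((norm_sub_le _ _).trans (by linarith [he1 z hz, he1 z' hz']))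
    obtain ⟨r', hr', hyr'⟩ := hcovs ((p - q) - (gridHom k s z - gridHom k s z')) (fun i => by
      have h1 := hpz i trivial
      have h2 := hqz i trivial
      simp only [Pi.sub_apply, gridHom_apply]
      rw [abs_le]
      constructor <;> linarith [h1.1, h1.2, h2.1, h2.2])
    refine ⟨x z - x z', Finset.sub_mem_sub (hx z hz) (hx z' hz'), y, hy, r + r', fun i => ?_, ?_⟩
    · rw [Pi.add_apply]
      exact (abs_add_le _ _).trans (by linarith [hr i, hr' i])
    · simp only [Pi.add_apply, add_smul, Finset.sum_add_distrib]
      rw [← hyr', hxe z hz, hxe z' hz']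
      have h3 : ∑ i, r i • v i = φ (e z) - φ (e z') - y := by
        rw [← map_sub, hyr]; abel
      rw [h3]
      abel
  · have hcount : (ballCount L R : ℝ) ≤ B * F.card := by
      refine (ballCount_boxVec_le hh'0 hR).trans ?_
      have h1 : ∏ i, (2 * (h' i : ℝ) + 1) ≤ 3 ^ (k + d) * ∏ i, (2 * (h i : ℝ) + 1) := by
        calc ∏ i, (2 * (h' i : ℝ) + 1) ≤ ∏ i, 3 * (2 * (h i : ℝ) + 1) := by
              refine Finset.prod_le_prod (fun i _ => by positivity) fun i _ => ?_
              rw [hh']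
              push_cast
              linarith [(h i).cast_nonneg (α := ℝ)]
          _ = _ := by
              rw [Finset.prod_mul_distrib, Finset.prod_const, Finset.card_univ, Fintype.card_fin]
      have h2 : ∏ i, (2 * (h i : ℝ) + 1) ≤ C₀ * F.card :=
        hprod.trans (mul_le_mul_of_nonneg_right (le_max_left _ _) (by positivity))
      calc (R + 1) ^ (k + d) * ∏ i, (2 * (h' i : ℝ) + 1)
          ≤ (R + 1) ^ (k + d) * (3 ^ (k + d) * (C₀ * F.card)) := by
            gcongr
            exact h1.trans (by gcongr)
        _ = B * F.card := by rw [hB]; ring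
    have hcount' : (ballCount L R : ℝ≥0∞) ≤ ENNReal.ofReal B * F.card := by
      rw [← ENNReal.ofReal_natCast, ← ENNReal.ofReal_natCast, ← ENNReal.ofReal_mul hB0]
      exact ENNReal.ofReal_le_ofReal hcount
    have hFs : (F.card : ℝ≥0∞) * ENNReal.ofReal s ^ k ≤ ENNReal.ofReal D * volume K := by
      refine le_trans (mul_le_mul_left ?_ _) hFF
      exact_mod_cast Finset.card_le_card_add_self
    calc ((∏ i, (2 * g i + 1) : ℕ) : ℝ≥0∞) * ENNReal.ofReal |(Matrix.of v).det|
        ≤ k ^ k * (ballCount L R * ENNReal.ofReal (s * M) ^ k) := hvol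
      _ ≤ k ^ k * (ENNReal.ofReal B * F.card * (ENNReal.ofReal s * M) ^ k) := by
          rw [ENNReal.ofReal_mul hs.le, ENNReal.ofReal_natCast]
          gcongr
      _ = k ^ k * (ENNReal.ofReal B * M ^ k * (F.card * ENNReal.ofReal s ^ k)) := by
          rw [mul_pow]; ring
      _ ≤ k ^ k * (ENNReal.ofReal B * M ^ k * (ENNReal.ofReal D * volume K)) := by gcongr
      _ = ENNReal.ofReal (k ^ k * (B * M ^ k * D)) * volume K := by
          rw [ENNReal.ofReal_mul (by positivity), ENNReal.ofReal_mul (by positivity),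
            ENNReal.ofReal_mul (by positivity), ENNReal.ofReal_pow (by positivity),
            ENNReal.ofReal_pow (by positivity), ENNReal.ofReal_natCast, ENNReal.ofReal_natCast]
          ring
      _ ≤ _ := by
          gcongr
          exact le_max_right _ _

/-- A symmetric progression whose steps satisfy no short relation, together with a symmetric
parallelotope, is contained in the sum of a proper progression and a parallelotope. -/
theorem exists_properGAP_parallelotope {k d : ℕ} (b : Fin d → Fin k → ℝ) (g : Fin d → ℕ)
    (hb : ∀ c : Fin d → ℤ, (∀ i, |c i| ≤ (2 * g i : ℕ)) → ∑ i, c i • b i = 0 → c = 0)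
    (v : Fin k → Fin k → ℝ) :
    ∃ P Q : Set (Fin k → ℝ), IsProperGAPR k d P ∧ IsParallelotope k Q ∧
      (∀ y ∈ symGAP b g, ∀ r : Fin k → ℝ, (∀ i, |r i| ≤ 3) → y + ∑ i, r i • v i ∈ P + Q) ∧
      P.ncard ≤ ∏ i, (2 * g i + 1) ∧
      volume Q = 6 ^ k * ENNReal.ofReal |(Matrix.of v).det| := by
  set f : (Fin d → ℕ) → Fin k → ℝ := fun lam => ∑ i, (lam i : ℝ) • b i with hf
  set I : Set (Fin d → ℕ) := {lam | ∀ i, 1 ≤ lam i ∧ lam i ≤ 2 * g i + 1} with hI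
  set x₀ : Fin k → ℝ := -(∑ i, (3 : ℝ) • v i) - ∑ i, ((g i : ℝ) + 1) • b i with hx₀
  have hIset : I = (Fintype.piFinset fun i => Finset.Icc 1 (2 * g i + 1) : Finset (Fin d → ℕ)) := by
    ext lam
    simp only [hI, Finset.mem_coe, Fintype.mem_piFinset, Finset.mem_Icc, mem_ofPred_eq]
  have hQ : (fun lam : Fin k → ℝ => x₀ + ∑ i, lam i • (6 : ℝ) • v i) '' Icc 0 1 =
      x₀ +ᵥ (fun r : Fin k → ℝ => ∑ i, r i • v i) '' Icc 0 (fun _ => 6) := by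
    ext p
    constructor
    · rintro ⟨lam, hlam, rfl⟩
      refine ⟨_, ⟨fun i => lam i * 6, ⟨fun i => ?_, fun i => ?_⟩, rfl⟩, ?_⟩
      · exact mul_nonneg (hlam.1 i) (by norm_num)
      · have : lam i ≤ 1 := hlam.2 i
        simp only
        linarith
      · simp only [mul_smul, vadd_eq_add]
    · rintro ⟨_, ⟨r, hr, rfl⟩, rfl⟩
      refine ⟨fun i => r i / 6, ⟨fun i => div_nonneg (hr.1 i) (by norm_num), fun i => ?_⟩, ?_⟩
      · have : r i ≤ 6 := hr.2 i
        simp only [Pi.one_apply]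
        linarith
      · simp only [smul_smul, vadd_eq_add]
        congr 1
        refine Finset.sum_congr rfl fun i _ => ?_
        rw [div_mul_cancel₀ _ (by norm_num)]
  refine ⟨f '' I, _, ⟨b, fun i => 2 * g i + 1, fun i => Nat.succ_pos _, rfl, ?_⟩,
    ⟨x₀, fun i => (6 : ℝ) • v i, rfl⟩, ?_, ?_, ?_⟩
  · intro lam hlam lam' hlam' heq
    have h1 := hb (fun i => (lam i : ℤ) - lam' i) (fun i => by
      have h2 : 1 ≤ lam i ∧ lam i ≤ 2 * g i + 1 := hlam i
      have h3 : 1 ≤ lam' i ∧ lam' i ≤ 2 * g i + 1 := hlam' i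
      rw [abs_le]
      push_cast
      omega) (by
      rw [← sub_eq_zero] at heq
      rw [← heq, ← Finset.sum_sub_distrib]
      refine Finset.sum_congr rfl fun i _ => ?_
      rw [← sub_smul, ← Int.cast_smul_eq_zsmul ℝ]
      push_cast
      rfl)
    ext i
    have h2 := congrFun h1 i
    simp only [Pi.zero_apply] at h2
    omega
  · rintro _ ⟨c, hc, rfl⟩ r hr
    have hc' : ∀ i, 0 ≤ c i + g i := fun i => by
      have := (abs_le.1 (hc i)).1
      omega
    refine ⟨f fun i => (c i + g i).toNat + 1, ⟨_, fun i => ?_, rfl⟩,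
      x₀ + ∑ i, ((r i + 3) / 6) • (6 : ℝ) • v i, ⟨fun i => (r i + 3) / 6, ⟨fun i => ?_, fun i => ?_⟩,
      rfl⟩, ?_⟩
    · have := (abs_le.1 (hc i)).2
      have := hc' i
      omega
    · have := (abs_le.1 (hr i)).1
      simp only [Pi.zero_apply]
      linarith
    · have := (abs_le.1 (hr i)).2
      simp only [Pi.one_apply]
      linarith
    · have h1 : f (fun i => (c i + g i).toNat + 1) =
          ∑ i, c i • b i + ∑ i, ((g i : ℝ) + 1) • b i := by
        rw [hf, ← Finset.sum_add_distrib]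
        refine Finset.sum_congr rfl fun i _ => ?_
        rw [← Int.cast_smul_eq_zsmul ℝ, ← add_smul]
        congr 1
        have h2 : (((c i + g i).toNat : ℤ) : ℝ) = ((c i + g i : ℤ) : ℝ) := by
          rw [Int.toNat_of_nonneg (hc' i)]
        push_cast at h2 ⊢
        rw [h2]
        ring
      have h2 : ∑ i, ((r i + 3) / 6) • (6 : ℝ) • v i = ∑ i, r i • v i + ∑ i, (3 : ℝ) • v i := by
        rw [← Finset.sum_add_distrib]
        refine Finset.sum_congr rfl fun i _ => ?_
        rw [smul_smul, div_mul_cancel₀ _ (by norm_num), add_smul]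
      simp only
      rw [h1, h2, hx₀]
      abel
  · rw [hIset]
    refine (ncard_image_le (Finset.finite_toSet _)).trans ?_
    rw [ncard_coe_finset, Fintype.card_piFinset]
    simp
  · rw [hQ, measure_vadd, volume_image_sum_smul, Real.volume_Icc_pi]
    simp [mul_comm]

theorem stmt_9 (k d : ℕ) (hk : 1 ≤ k) (ε : ℝ) (hε : 0 < ε) :
    ∃ C : ℝ, 0 < C ∧
      ∀ A : Set (Fin k → ℝ), MeasurableSet A → 0 < volume A → volume A < ⊤ →
        volume (A + A) ≤ ENNReal.ofReal (2 ^ (k + d + 1) - ε) * volume A →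
        ∃ X P Q : Set (Fin k → ℝ), X.Finite ∧ IsProperGAPR k d P ∧ IsParallelotope k Q ∧
          A ⊆ X + P + Q ∧ (X.ncard : ℝ) ≤ C ∧
          (P.ncard : ℝ≥0∞) * volume Q ≤ ENNReal.ofReal C * volume A := by
  rcases le_or_gt (2 ^ (k + d + 1) - ε) 0 with hneg | hpos
  · refine ⟨1, one_pos, fun A _ hA0 _ hAA => ?_⟩
    rw [ENNReal.ofReal_of_nonpos hneg, zero_mul] at hAA
    obtain ⟨a, ha⟩ := nonempty_of_measure_ne_zero hA0.ne'
    have h1 : volume A ≤ volume (A + A) := by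
      rw [← measure_vadd volume a A]
      exact measure_mono (by rintro _ ⟨x, hx, rfl⟩; exact add_mem_add ha hx)
    exact absurd (h1.trans hAA) (not_le.2 hA0)
  set D : ℝ := 2 ^ (k + d + 1) - ε with hD
  set D' : ℝ := 2 ^ (k + d + 1) - ε / 2 with hD'
  have hDD' : D < D' := by rw [hD, hD']; linarith
  have hD'0 : 0 < D' := hpos.trans hDD'
  obtain ⟨C, hC, H⟩ := exists_cover_sub_of_isCompact k d (half_pos hε) (by rw [hD'] at hD'0; linarith)
  refine ⟨max (D' * C) (6 ^ k * C) + 1, by positivity, fun A hAm hA0 hAtop hAA => ?_⟩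
  have hr : ENNReal.ofReal (D / D') * volume A < volume A := by
    conv_rhs => rw [← one_mul (volume A)]
    rw [ENNReal.mul_lt_mul_iff_left hA0.ne' hAtop.ne, ENNReal.ofReal_lt_one]
    exact (div_lt_one hD'0).2 hDD'
  obtain ⟨K, hKA, hK, hKr⟩ := hAm.exists_lt_isCompact hr
  have hK0 : volume K ≠ 0 := (lt_of_le_of_lt zero_le hKr).ne'
  have hKtop : volume K ≠ ⊤ := hK.measure_lt_top.ne
  have hAK : volume (A + A) < ENNReal.ofReal D' * volume K := by
    refine hAA.trans_lt ?_
    calc ENNReal.ofReal D * volume A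
        = ENNReal.ofReal D' * (ENNReal.ofReal (D / D') * volume A) := by
          rw [← mul_assoc, ← ENNReal.ofReal_mul hD'0.le, mul_div_cancel₀ _ hD'0.ne']
      _ < _ := (ENNReal.mul_lt_mul_iff_right (by simpa using hD'0) ENNReal.ofReal_ne_top).2 hKr
  obtain ⟨Y, hYcard, hYA⟩ := exists_cover_sub_of_volume_add_le hK.measurableSet hKA hK0 hKtop
    hD'0.le hAK.le
  obtain ⟨Z, b, g, v, hZ, hv, hcov, hvol⟩ := H K hK hK0
    ((measure_mono (add_subset_add hKA hKA)).trans_lt hAK)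
  set i₀ : Fin k := ⟨0, hk⟩ with hi₀
  have hv₀ : v i₀ ≠ 0 := fun h0 => hv (Matrix.det_eq_zero_of_row_eq_zero i₀ fun j => congrFun h0 j)
  obtain ⟨b', hb', hbb'⟩ := exists_proper_perturbation b g hv₀
  obtain ⟨P, Q, hP, hQ, hPQ, hPcard, hQvol⟩ := exists_properGAP_parallelotope b' g hb' v
  classical
  refine ⟨(Y + Z : Finset (Fin k → ℝ)), P, Q, Finset.finite_toSet _, hP, hQ, ?_, ?_, ?_⟩
  · intro x hx
    obtain ⟨y, hy, w, hw, rfl⟩ := hYA hx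
    obtain ⟨z, hz, p, hp, r, hr, rfl⟩ := hcov w hw
    obtain ⟨p', hp', ρ, hρ, rfl⟩ := hbb' p hp
    have hmem := hPQ p' hp' (r + Pi.single i₀ ρ) (fun i => by
      rw [Pi.add_apply]
      refine (abs_add_le _ _).trans ?_
      have h1 : |(Pi.single i₀ ρ : Fin k → ℝ) i| ≤ 1 := by
        by_cases hi : i = i₀
        · subst hi; simpa using hρ
        · simp [hi]
      linarith [hr i])
    have hsum : ∑ i, (r + Pi.single i₀ ρ : Fin k → ℝ) i • v i = ∑ i, r i • v i + ρ • v i₀ := by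
      simp only [Pi.add_apply, add_smul, Finset.sum_add_distrib]
      congr 1
      rw [Finset.sum_eq_single i₀]
      · simp
      · intro i _ hi; simp [hi]
      · simp
    rw [hsum] at hmem
    rw [add_assoc]
    refine ⟨y + z, Finset.mem_coe.2 (Finset.add_mem_add hy hz), _, hmem, ?_⟩
    simp only
    abel
  · rw [ncard_coe_finset]
    have h1 : ((Y + Z).card : ℝ) ≤ Y.card * Z.card := by exact_mod_cast Finset.card_add_le
    have h2 : (Y.card : ℝ) * Z.card ≤ D' * C := mul_le_mul hYcard hZ (by positivity) hD'0.le
    linarith [le_max_left (D' * C) (6 ^ k * C)]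
  · calc (P.ncard : ℝ≥0∞) * volume Q
        ≤ (∏ i, (2 * g i + 1) : ℕ) * (6 ^ k * ENNReal.ofReal |(Matrix.of v).det|) := by
          rw [hQvol]
          gcongr
      _ = 6 ^ k * ((∏ i, (2 * g i + 1) : ℕ) * ENNReal.ofReal |(Matrix.of v).det|) := by ring
      _ ≤ 6 ^ k * (ENNReal.ofReal C * volume A) := by
          refine mul_le_mul_right (hvol.trans ?_) _
          gcongr
      _ = ENNReal.ofReal (6 ^ k * C) * volume A := by
          rw [ENNReal.ofReal_mul (by positivity), ENNReal.ofReal_pow (by norm_num), mul_assoc]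
          norm_num
      _ ≤ _ := by
          gcongr
          linarith [le_max_right (D' * C) (6 ^ k * C)]
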